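/- arXiv:2406.13773 — 2 statements merged into one kernel-verified Lean document; each statement's English description precedes it below -/
import Mathlib

section
/- Let d ≥ 1 be an integer and p > d+1. There exist γ₀, γ₁ > 0 depending only on p and d such that for every τ > 0, every measurable set E ⊆ ℝ and all reals s⁻ < s < s⁺ such that χ_E is a.e. constant on (s⁻,s) and a.e. constant on (s,s⁺), one has r_τ(E,s) ≥ −γ₀ + γ₁ min{(s−s⁻)^{−(p−d−1)}, τ^{−1}} + γ₁ min{(s⁺−s)^{−(p−d−1)}, τ^{−1}}. Moreover, there exist τ₀, η₀ > 0 depending only on p and d such that if in addition min{s−s⁻, s⁺−s} < η₀ and 0 < τ < τ₀, then r_τ(E,s) ≥ (γ₁/2) min{(s−s⁻)^{−(p−d−1)}, (s⁺−s)^{−(p−d−1)}, τ^{−1}}. -/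
open MeasureTheory Filter
open scoped ENNReal

noncomputable section

/-- The rescaled one-dimensional kernel `K̄_τ(ρ) = |ρ|^{d−1} max(τ^{1/(p−d−1)}, |ρ|)^{−p}`. -/
def Kbar (d : ℕ) (p τ : ℝ) (ρ : ℝ) : ℝ :=
  |ρ| ^ ((d : ℝ) - 1) * (max (τ ^ (1 / (p - d - 1))) |ρ|) ^ (-p)

/-- The indicator function of a set of reals. -/
def ind (E : Set ℝ) : ℝ → ℝ := Set.indicator E fun _ => (1 : ℝ)

/-- `χ_E` is a.e. constant on `I`. -/
def AEConstOn (E : Set ℝ) (I : Set ℝ) : Prop :=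
  ∃ c : ℝ, ∀ᵐ u ∂(volume.restrict I), ind E u = c

/-- The quantity `r_τ(E,s)` with finite neighbours `sm < s < sp`. -/
def rtau (d : ℕ) (p τ : ℝ) (E : Set ℝ) (sm s sp : ℝ) : ℝ :=
  (∫ ρ in Set.Ioo (-1 : ℝ) 1, |ρ| * Kbar d p τ ρ)
  - (∫ u in Set.Ioo sm s, ∫ ρ in Set.Ioi (0 : ℝ), |ind E (u + ρ) - ind E u| * Kbar d p τ ρ)
  - (∫ u in Set.Ioo s sp, ∫ ρ in Set.Iio (0 : ℝ), |ind E (u + ρ) - ind E u| * Kbar d p τ ρ)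

/-- The quantity `r_τ(E,s)` with possibly infinite neighbours `sm < s < sp`. -/
def rtauE (d : ℕ) (p τ : ℝ) (E : Set ℝ) (sm : EReal) (s : ℝ) (sp : EReal) : ℝ :=
  (∫ ρ in Set.Ioo (-1 : ℝ) 1, |ρ| * Kbar d p τ ρ)
  - (∫ u in {u : ℝ | sm < (u : EReal) ∧ u < s},
      ∫ ρ in Set.Ioi (0 : ℝ), |ind E (u + ρ) - ind E u| * Kbar d p τ ρ)
  - (∫ u in {u : ℝ | s < u ∧ (u : EReal) < sp},
      ∫ ρ in Set.Iio (0 : ℝ), |ind E (u + ρ) - ind E u| * Kbar d p τ ρ)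

/-- `(E,B)` is a one-dimensional set of locally finite perimeter: `B` is a closed, locally
finite set of jump points of `χ_E`. -/
def IsOneDPerimeterSet (E B : Set ℝ) : Prop :=
  MeasurableSet E ∧ IsClosed B ∧ (∀ K : Set ℝ, IsCompact K → (B ∩ K).Finite) ∧
  (∀ a b : ℝ, a < b → Set.Ioo a b ∩ B = ∅ → AEConstOn E (Set.Ioo a b)) ∧
  (∀ s ∈ B, ∀ a b : ℝ, a < s → s < b →
    Set.Ioo a s ∩ B = ∅ → Set.Ioo s b ∩ B = ∅ →
    ∀ c₁ c₂ : ℝ,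
      (∀ᵐ u ∂(volume.restrict (Set.Ioo a s)), ind E u = c₁) →
      (∀ᵐ u ∂(volume.restrict (Set.Ioo s b)), ind E u = c₂) →
      c₁ ≠ c₂)

/-- The successor `s⁺` of `s` in `B` (`+∞` if none). -/
def succPt (B : Set ℝ) (s : ℝ) : EReal :=
  sInf ((fun t : ℝ => (t : EReal)) '' {t | t ∈ B ∧ s < t})

/-- The predecessor `s⁻` of `s` in `B` (`−∞` if none). -/
def predPt (B : Set ℝ) (s : ℝ) : EReal :=
  sSup ((fun t : ℝ => (t : EReal)) '' {t | t ∈ B ∧ t < s})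

/-- `r_τ(E,s)` computed with the neighbours of `s` in the boundary `B`. -/
def rPt (d : ℕ) (p τ : ℝ) (E B : Set ℝ) (s : ℝ) : ℝ :=
  rtauE d p τ E (predPt B s) s (succPt B s)

/-- `x^{-q}` for `x : EReal`, with the convention that it vanishes at `x = +∞`. -/
def powNegE (q : ℝ) (x : EReal) : ℝ :=
  if x = ⊤ then 0 else x.toReal ^ (-q)

lemma Kbar_nonneg (d : ℕ) (p τ : ℝ) (hτ : 0 < τ) (ρ : ℝ) : 0 ≤ Kbar d p τ ρ := by
  unfold Kbar
  have := Real.rpow_pos_of_pos hτ (1 / (p - d - 1))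
  have : 0 ≤ max (τ ^ (1 / (p - d - 1))) |ρ| := le_max_of_le_right (abs_nonneg _)
  positivity

lemma Kbar_neg (d : ℕ) (p τ : ℝ) (ρ : ℝ) : Kbar d p τ (-ρ) = Kbar d p τ ρ := by
  simp [Kbar]

lemma Kbar_cont (d : ℕ) (hd : 1 ≤ d) (p τ : ℝ) (hτ : 0 < τ) : Continuous (Kbar d p τ) := by
  unfold Kbar
  have h1 := Real.rpow_pos_of_pos hτ (1 / (p - d - 1))
  have hd' : (1 : ℝ) ≤ d := by exact_mod_cast hd
  apply Continuous.mul
  · exact continuous_abs.rpow_const (fun x => Or.inr (by linarith))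
  · exact (continuous_const.max continuous_abs).rpow_const
      (fun x => Or.inl (lt_of_lt_of_le h1 (le_max_left _ _)).ne')

lemma Kbar_le (d : ℕ) (p τ : ℝ) (hp : (d : ℝ) + 1 < p) {ρ : ℝ} (hρ : 0 < ρ) :
    ρ * Kbar d p τ ρ ≤ ρ ^ (-(p - d)) := by
  unfold Kbar
  rw [abs_of_pos hρ]
  have h0 : (0 : ℝ) ≤ d := by positivity
  have h1 : (max (τ ^ (1 / (p - d - 1))) ρ) ^ (-p) ≤ ρ ^ (-p) :=
    Real.rpow_le_rpow_of_nonpos hρ (le_max_right _ _) (by linarith)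
  calc ρ * (ρ ^ ((d : ℝ) - 1) * (max (τ ^ (1 / (p - d - 1))) ρ) ^ (-p))
      ≤ ρ * (ρ ^ ((d : ℝ) - 1) * ρ ^ (-p)) := by gcongr
    _ = ρ ^ (1 : ℝ) * (ρ ^ ((d : ℝ) - 1) * ρ ^ (-p)) := by rw [Real.rpow_one]
    _ = ρ ^ (-(p - d)) := by
      rw [← Real.rpow_add hρ, ← Real.rpow_add hρ]; congr 1; ring

lemma Kbar_eq (d : ℕ) (p τ : ℝ) {ρ : ℝ} (hρ : 0 < ρ) (h : τ ^ (1 / (p - d - 1)) ≤ ρ) :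
    Kbar d p τ ρ = ρ ^ (-(p - d - 1) - 2) := by
  unfold Kbar
  rw [abs_of_pos hρ, max_eq_right h, ← Real.rpow_add hρ]; congr 1; ring

lemma rKbar_int (d : ℕ) (hd : 1 ≤ d) (p τ : ℝ) (hp : (d : ℝ) + 1 < p) (hτ : 0 < τ) :
    IntegrableOn (fun ρ => ρ * Kbar d p τ ρ) (Set.Ioi 0) := by
  have hc : Continuous (fun ρ => ρ * Kbar d p τ ρ) := continuous_id.mul (Kbar_cont d hd p τ hτ)
  rw [← Set.Ioc_union_Ioi_eq_Ioi (zero_le_one)]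
  refine IntegrableOn.union ?_ ?_
  · exact (hc.integrableOn_Icc (a := 0) (b := 1)).mono_set Set.Ioc_subset_Icc_self
  · refine Integrable.mono' (integrableOn_Ioi_rpow_of_lt (a := -(p - d)) (by linarith)
      (zero_lt_one)) hc.aestronglyMeasurable ?_
    filter_upwards [ae_restrict_mem measurableSet_Ioi] with ρ hρ
    have hρ' : (0 : ℝ) < ρ := lt_trans zero_lt_one hρ
    rw [Real.norm_of_nonneg (mul_nonneg hρ'.le (Kbar_nonneg d p τ hτ ρ))]
    exact Kbar_le d p τ hp hρ'

lemma Kbar_int (d : ℕ) (hd : 1 ≤ d) (p τ : ℝ) (hp : (d : ℝ) + 1 < p) (hτ : 0 < τ) :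
    IntegrableOn (Kbar d p τ) (Set.Ioi 0) := by
  have hc := Kbar_cont d hd p τ hτ
  have h := rKbar_int d hd p τ hp hτ
  rw [← Set.Ioc_union_Ioi_eq_Ioi (zero_le_one)] at h ⊢
  refine IntegrableOn.union ?_ ?_
  · exact (hc.integrableOn_Icc (a := 0) (b := 1)).mono_set Set.Ioc_subset_Icc_self
  · refine Integrable.mono' h.right_of_union hc.aestronglyMeasurable ?_
    filter_upwards [ae_restrict_mem measurableSet_Ioi] with ρ hρ
    rw [Real.norm_of_nonneg (Kbar_nonneg d p τ hτ ρ)]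
    exact le_mul_of_one_le_left (Kbar_nonneg d p τ hτ ρ) (le_of_lt hρ)

lemma first_term (d : ℕ) (p τ : ℝ) :
    (∫ ρ in Set.Ioo (-1 : ℝ) 1, |ρ| * Kbar d p τ ρ)
      = 2 * ∫ ρ in Set.Ioc (0 : ℝ) 1, ρ * Kbar d p τ ρ := by
  have h := integral_comp_abs (f := (Set.Iio (1 : ℝ)).indicator (fun ρ => ρ * Kbar d p τ ρ))
  rw [setIntegral_indicator measurableSet_Iio] at h
  have e : Set.Ioi (0 : ℝ) ∩ Set.Iio 1 = Set.Ioo 0 1 := rfl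
  rw [e] at h
  rw [integral_Ioc_eq_integral_Ioo, ← h, ← integral_indicator measurableSet_Ioo]
  congr 1
  ext x
  have hk : Kbar d p τ |x| = Kbar d p τ x := by simp [Kbar]
  by_cases hx : |x| < 1
  · rw [Set.indicator_of_mem (show x ∈ Set.Ioo (-1 : ℝ) 1 from abs_lt.1 hx),
      Set.indicator_of_mem (show |x| ∈ Set.Iio (1 : ℝ) from hx), hk]
  · rw [Set.indicator_of_notMem (show x ∉ Set.Ioo (-1 : ℝ) 1 from fun h => hx (abs_lt.2 h)),
      Set.indicator_of_notMem (show |x| ∉ Set.Iio (1 : ℝ) from hx)]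

lemma g_facts (K : ℝ → ℝ) (hK : IntegrableOn K (Set.Ioi 0)) (s h : ℝ) (hh : 0 < h) :
    IntegrableOn (fun u => ∫ ρ in Set.Ioi (0 : ℝ), (Set.Ioi (s - u)).indicator K ρ)
      (Set.Ioo (s - h) s) ∧
    (∫ u in Set.Ioo (s - h) s, ∫ ρ in Set.Ioi (0 : ℝ), (Set.Ioi (s - u)).indicator K ρ)
      = ∫ ρ in Set.Ioi (0 : ℝ), min ρ h * K ρ := by
  have hprod : Integrable (fun z : ℝ × ℝ => (Set.Ioi (s - z.1)).indicator K z.2)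
      ((volume.restrict (Set.Ioo (s - h) s)).prod (volume.restrict (Set.Ioi 0))) := by
    have h1 : Integrable (fun z : ℝ × ℝ => K z.2)
      ((volume.restrict (Set.Ioo (s - h) s)).prod (volume.restrict (Set.Ioi 0))) :=
      Integrable.comp_snd hK _
    have hS : MeasurableSet {z : ℝ × ℝ | s - z.1 < z.2} :=
      measurableSet_lt (by fun_prop) (by fun_prop)
    exact h1.indicator hS
  refine ⟨hprod.integral_prod_left, ?_⟩
  rw [integral_integral_swap hprod]
  refine setIntegral_congr_fun measurableSet_Ioi (fun ρ hρ => ?_)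
  have hρ' : (0 : ℝ) < ρ := hρ
  have e : ∀ u, (Set.Ioi (s - u)).indicator K ρ = (Set.Ioi (s - ρ)).indicator (fun _ => K ρ) u := by
    intro u
    by_cases hu : s - u < ρ
    · rw [Set.indicator_of_mem (show ρ ∈ Set.Ioi (s - u) from hu), Set.indicator_of_mem]
      simp only [Set.mem_Ioi]; linarith
    · rw [Set.indicator_of_notMem (show ρ ∉ Set.Ioi (s - u) from hu), Set.indicator_of_notMem]
      simp only [Set.mem_Ioi]; intro h; apply hu; linarith
  simp only [e]
  rw [setIntegral_indicator measurableSet_Ioi, setIntegral_const, smul_eq_mul]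
  congr 1
  have e2 : Set.Ioo (s - h) s ∩ Set.Ioi (s - ρ) = Set.Ioo (max (s - h) (s - ρ)) s := by
    ext x; simp only [Set.mem_inter_iff, Set.mem_Ioo, Set.mem_Ioi, max_lt_iff]; tauto
  rw [e2, Real.volume_real_Ioo_of_le (max_le (by linarith) (by linarith))]
  rcases le_total ρ h with h1 | h1
  · rw [min_eq_left h1, max_eq_right (by linarith)]; ring
  · rw [min_eq_right h1, max_eq_left (by linarith)]; ring

lemma side_le (f K : ℝ → ℝ) (hK : IntegrableOn K (Set.Ioi 0)) (hK0 : ∀ ρ, 0 ≤ K ρ)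
    (hf : ∀ x y, |f x - f y| ≤ 1) (s h : ℝ) (hh : 0 < h) (c : ℝ)
    (hc : ∀ᵐ u ∂(volume.restrict (Set.Ioo (s - h) s)), f u = c) :
    (∫ u in Set.Ioo (s - h) s, ∫ ρ in Set.Ioi (0 : ℝ), |f (u + ρ) - f u| * K ρ)
      ≤ ∫ ρ in Set.Ioi (0 : ℝ), min ρ h * K ρ := by
  obtain ⟨g1, g2⟩ := g_facts K hK s h hh
  rw [← g2]
  refine integral_mono_of_nonneg ?_ g1 ?_
  · exact Eventually.of_forall fun u => integral_nonneg fun ρ =>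
      mul_nonneg (abs_nonneg _) (hK0 _)
  filter_upwards [hc, ae_restrict_mem measurableSet_Ioo] with u hu hmem
  refine integral_mono_of_nonneg ?_ (hK.indicator measurableSet_Ioi) ?_
  · exact Eventually.of_forall fun ρ => mul_nonneg (abs_nonneg _) (hK0 _)
  have hc' := (ae_restrict_iff' measurableSet_Ioo).1 hc
  have hc2 : ∀ᵐ ρ : ℝ, u + ρ ∈ Set.Ioo (s - h) s → f (u + ρ) = c :=
    (measurePreserving_add_left volume u).quasiMeasurePreserving.ae hc'
  have hs : ∀ᵐ ρ : ℝ, ρ ≠ s - u := by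
    simp [ae_iff]
  filter_upwards [ae_restrict_of_ae hc2, ae_restrict_of_ae hs,
    ae_restrict_mem measurableSet_Ioi] with ρ h1 h2 h3
  have h3' : 0 < ρ := h3
  by_cases hr : s - u < ρ
  · rw [Set.indicator_of_mem (show ρ ∈ Set.Ioi (s - u) from hr)]
    exact mul_le_of_le_one_left (hK0 _) (hf _ _)
  · have : ρ < s - u := lt_of_le_of_ne (not_lt.1 hr) h2
    rw [Set.indicator_of_notMem (show ρ ∉ Set.Ioi (s - u) from hr),
      h1 ⟨by linarith [hmem.1], by linarith⟩, hu]
    simp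

lemma Kmin_le (d : ℕ) (hd : 1 ≤ d) (p : ℝ) (hp : (d : ℝ) + 1 < p) (τ : ℝ) (hτ : 0 < τ)
    (h : ℝ) (hh : 0 < h) :
    (∫ ρ in Set.Ioi (0 : ℝ), min ρ h * Kbar d p τ ρ) +
      2 * (4 : ℝ) ^ (-(p - d - 1) - 2) * min (h ^ (-(p - d - 1))) τ⁻¹ ≤
    (∫ ρ in Set.Ioc (0 : ℝ) 1, ρ * Kbar d p τ ρ) + (1 / (p - d - 1)
      + 2 * (4 : ℝ) ^ (-(p - d - 1) - 2) * 4 ^ (p - d - 1)) := by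
  have hr := rKbar_int d hd p τ hp hτ
  have hq : 0 < p - d - 1 := by linarith
  have hKn := Kbar_nonneg d p τ hτ
  set ε := τ ^ (1 / (p - d - 1)) with hε
  have hε0 : 0 < ε := Real.rpow_pos_of_pos hτ _
  have hετ : ε ^ (-(p - d - 1)) = τ⁻¹ := by
    rw [hε, ← Real.rpow_mul hτ.le, ← Real.rpow_neg_one]; congr 1; field_simp
  have hm : min (h ^ (-(p - d - 1))) τ⁻¹ = (max h ε) ^ (-(p - d - 1)) := by
    rw [← hετ]
    rcases le_total h ε with h1 | h1
    · rw [max_eq_right h1, min_eq_right]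
      exact Real.rpow_le_rpow_of_nonpos hh h1 (by linarith)
    · rw [max_eq_left h1, min_eq_left]
      exact Real.rpow_le_rpow_of_nonpos hε0 h1 (by linarith)
  rw [hm]
  set m := max h ε with hmdef
  have hm0 : 0 < m := lt_max_of_lt_left hh
  have hhm : h ≤ m := le_max_left _ _
  have hεm : ε ≤ m := le_max_right _ _
  set q := p - d - 1 with hqdef
  have htail : ∫ ρ in Set.Ioi (1 : ℝ), ρ ^ (-(p - d)) = 1 / q := by
    rw [integral_Ioi_rpow_of_lt (by linarith) zero_lt_one, Real.one_rpow]
    rw [show -(p - d) + 1 = -q by rw [hqdef]; ring]; rw [neg_div_neg_eq]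
  have htI : IntegrableOn (fun ρ : ℝ => ρ ^ (-(p - d))) (Set.Ioi 1) :=
    integrableOn_Ioi_rpow_of_lt (by linarith) zero_lt_one
  have hminI : IntegrableOn (fun ρ => min ρ h * Kbar d p τ ρ) (Set.Ioi 0) := by
    refine Integrable.mono' hr (((continuous_id.min continuous_const).mul
      (Kbar_cont d hd p τ hτ)).aestronglyMeasurable) ?_
    filter_upwards [ae_restrict_mem measurableSet_Ioi] with ρ hρ
    have hρ' : 0 < ρ := hρ
    rw [Real.norm_of_nonneg (mul_nonneg (le_min hρ'.le hh.le) (hKn ρ))]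
    exact mul_le_mul_of_nonneg_right (min_le_left _ _) (hKn ρ)
  -- general step
  have key : ∀ C : ℝ, (C = 0 ∨ 4 * m ≤ 1) →
      (∀ ρ, 2 * m < ρ → ρ < 4 * m → h * Kbar d p τ ρ + C ≤ ρ * Kbar d p τ ρ)
      → (∫ ρ in Set.Ioi (0 : ℝ), min ρ h * Kbar d p τ ρ) + 2 * m * C ≤
        (∫ ρ in Set.Ioc (0 : ℝ) 1, ρ * Kbar d p τ ρ) + 1 / q := by
    intro C hC0 hC
    have i1 : IntegrableOn ((Set.Ioo (2 * m) (4 * m)).indicator fun _ => C) (Set.Ioi 0) := by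
      refine Integrable.integrableOn ?_
      exact (integrable_indicator_iff measurableSet_Ioo).2 (integrableOn_const (by simp))
    have e1 : ∫ ρ in Set.Ioi (0 : ℝ), (Set.Ioo (2 * m) (4 * m)).indicator (fun _ => C) ρ
        = 2 * m * C := by
      rw [setIntegral_indicator measurableSet_Ioo, Set.inter_eq_right.2, setIntegral_const,
        Real.volume_real_Ioo_of_le (by linarith), smul_eq_mul]
      · ring
      · intro x hx; have := hx.1; simp only [Set.mem_Ioi]; linarith
    rw [← e1, ← integral_add hminI i1, ← htail]
    have hsplit : ∫ ρ in Set.Ioi (0 : ℝ), (min ρ h * Kbar d p τ ρ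
        + (Set.Ioo (2 * m) (4 * m)).indicator (fun _ => C) ρ) =
        (∫ ρ in Set.Ioc (0 : ℝ) 1, (min ρ h * Kbar d p τ ρ
        + (Set.Ioo (2 * m) (4 * m)).indicator (fun _ => C) ρ)) +
        ∫ ρ in Set.Ioi (1 : ℝ), (min ρ h * Kbar d p τ ρ
        + (Set.Ioo (2 * m) (4 * m)).indicator (fun _ => C) ρ) := by
      rw [← Set.Ioc_union_Ioi_eq_Ioi (zero_le_one), setIntegral_union
        (Set.Ioc_disjoint_Ioi le_rfl) measurableSet_Ioi]
      · exact (hminI.add i1).mono_set Set.Ioc_subset_Ioi_self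
      · exact (hminI.add i1).mono_set (Set.Ioi_subset_Ioi zero_le_one)
    rw [hsplit]
    refine add_le_add ?_ ?_
    · refine setIntegral_mono_on ((hminI.add i1).mono_set Set.Ioc_subset_Ioi_self)
        (hr.mono_set Set.Ioc_subset_Ioi_self) measurableSet_Ioc ?_
      intro ρ hρ
      by_cases hx : ρ ∈ Set.Ioo (2 * m) (4 * m)
      · rw [Set.indicator_of_mem hx]
        have := hC ρ hx.1 hx.2
        have h2 : min ρ h * Kbar d p τ ρ ≤ h * Kbar d p τ ρ :=
          mul_le_mul_of_nonneg_right (min_le_right _ _) (hKn ρ)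
        linarith
      · rw [Set.indicator_of_notMem hx, add_zero]
        exact mul_le_mul_of_nonneg_right (min_le_left _ _) (hKn ρ)
    · refine setIntegral_mono_on ((hminI.add i1).mono_set (Set.Ioi_subset_Ioi zero_le_one))
        htI measurableSet_Ioi ?_
      intro ρ hρ
      have hρ1 : 1 < ρ := hρ
      have hz : (Set.Ioo (2 * m) (4 * m)).indicator (fun _ => C) ρ = 0 := by
        rcases hC0 with hC0 | hC0
        · simp [hC0]
        · rw [Set.indicator_of_notMem]
          intro hx
          linarith [hx.2]
      rw [hz, add_zero]
      exact (mul_le_mul_of_nonneg_right (min_le_left _ _) (hKn ρ)).trans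
          (Kbar_le d p τ hp (by linarith))
  have h4 : (0 : ℝ) < 4 ^ (-q - 2) := by positivity
  have h4' : (0 : ℝ) < 4 ^ q := by positivity
  by_cases hm4 : 4 * m ≤ 1
  · have := key (m * (4 * m) ^ (-q - 2)) (Or.inr hm4) (by
      intro ρ h1 h2
      have hρ0 : 0 < ρ := by linarith
      have hk : (4 * m) ^ (-q - 2) ≤ Kbar d p τ ρ := by
        rw [Kbar_eq d p τ hρ0 (by rw [← hqdef, ← hε]; linarith)]
        exact Real.rpow_le_rpow_of_nonpos hρ0 h2.le (by linarith)
      have hmul : m * (4 * m) ^ (-q - 2) ≤ m * Kbar d p τ ρ := by gcongr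
      have : m * Kbar d p τ ρ ≤ (ρ - h) * Kbar d p τ ρ :=
        mul_le_mul_of_nonneg_right (by linarith) (hKn ρ)
      linarith)
    have e : 2 * m * (m * (4 * m) ^ (-q - 2)) = 2 * (4 : ℝ) ^ (-q - 2) * m ^ (-q) := by
      rw [Real.mul_rpow (by norm_num) hm0.le, Real.rpow_sub hm0 (-q) 2, Real.rpow_two]
      field_simp
    rw [e] at this
    have : 0 < 2 * (4 : ℝ) ^ (-q - 2) * 4 ^ q := by positivity
    linarith
  · have := key 0 (Or.inl rfl) (by
      intro ρ h1 h2
      rw [add_zero]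
      exact mul_le_mul_of_nonneg_right (by linarith) (hKn ρ))
    have hm5 : m ^ (-q) ≤ 4 ^ q := by
      have : m ^ (-q) ≤ (1 / 4 : ℝ) ^ (-q) :=
        Real.rpow_le_rpow_of_nonpos (by norm_num) (by linarith) (by linarith)
      rwa [one_div, Real.inv_rpow (by norm_num), ← Real.rpow_neg (by norm_num : (0:ℝ) ≤ 4), neg_neg] at this
    have : 2 * (4 : ℝ) ^ (-q - 2) * m ^ (-q) ≤ 2 * (4 : ℝ) ^ (-q - 2) * 4 ^ q := by gcongr
    linarith

lemma ind_diff (E : Set ℝ) (x y : ℝ) : |ind E x - ind E y| ≤ 1 := by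
  unfold ind
  by_cases hx : x ∈ E <;> by_cases hy : y ∈ E <;> simp [hx, hy]

lemma reflect (K F : ℝ → ℝ) (hK : ∀ ρ, K (-ρ) = K ρ) (s sp : ℝ) :
    (∫ u in Set.Ioo s sp, ∫ ρ in Set.Iio (0 : ℝ), |F (u + ρ) - F u| * K ρ) =
    ∫ u in Set.Ioo (-sp) (-s), ∫ ρ in Set.Ioi (0 : ℝ), |F (-(u + ρ)) - F (-u)| * K ρ := by
  have inner : ∀ u, (∫ ρ in Set.Iio (0 : ℝ), |F (u + ρ) - F u| * K ρ) =
      ∫ ρ in Set.Ioi (0 : ℝ), |F (u - ρ) - F u| * K ρ := by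
    intro u
    rw [← integral_Iic_eq_integral_Iio]
    have := integral_comp_neg_Iic (0 : ℝ) (fun ρ => |F (u - ρ) - F u| * K ρ)
    simpa [hK] using this
  simp only [inner]
  have e := (Measure.measurePreserving_neg (volume : Measure ℝ)).setIntegral_preimage_emb
    (MeasurableEquiv.neg ℝ).measurableEmbedding
    (fun u => ∫ ρ in Set.Ioi (0 : ℝ), |F (u - ρ) - F u| * K ρ) (Set.Ioo s sp)
  rw [← e]
  have e2 : (Neg.neg ⁻¹' Set.Ioo s sp : Set ℝ) = Set.Ioo (-sp) (-s) := by simp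
  rw [e2]
  have e3 : ∀ u ρ : ℝ, -(u + ρ) = -u - ρ := fun u ρ => by ring
  simp only [e3]

lemma rtau_lower (d : ℕ) (hd : 1 ≤ d) (p : ℝ) (hp : (d : ℝ) + 1 < p) (τ : ℝ) (hτ : 0 < τ)
    (E : Set ℝ) (sm s sp : ℝ) (h1 : sm < s) (h2 : s < sp)
    (hc1 : AEConstOn E (Set.Ioo sm s)) (hc2 : AEConstOn E (Set.Ioo s sp)) :
    rtau d p τ E sm s sp ≥ -(2 * (1 / (p - d - 1)
      + 2 * (4 : ℝ) ^ (-(p - d - 1) - 2) * 4 ^ (p - d - 1)))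
      + 2 * (4 : ℝ) ^ (-(p - d - 1) - 2) * min ((s - sm) ^ (-(p - d - 1))) τ⁻¹
      + 2 * (4 : ℝ) ^ (-(p - d - 1) - 2) * min ((sp - s) ^ (-(p - d - 1))) τ⁻¹ := by
  have hK := Kbar_int d hd p τ hp hτ
  have hK0 := Kbar_nonneg d p τ hτ
  obtain ⟨c1, hc1⟩ := hc1
  obtain ⟨c2, hc2⟩ := hc2
  have a1 := side_le (ind E) (Kbar d p τ) hK hK0 (ind_diff E) s (s - sm) (by linarith) c1
    (by rwa [show s - (s - sm) = sm by ring])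
  rw [show s - (s - sm) = sm by ring] at a1
  have a2 := side_le (fun x => ind E (-x)) (Kbar d p τ) hK hK0 (fun x y => ind_diff E _ _)
    (-s) (sp - s) (by linarith) c2 (by
      rw [show -s - (sp - s) = -sp by ring]
      rw [ae_restrict_iff' measurableSet_Ioo] at hc2 ⊢
      have := (Measure.measurePreserving_neg (volume : Measure ℝ)).quasiMeasurePreserving.ae hc2
      filter_upwards [this] with u hu hmem
      exact hu ⟨by linarith [hmem.2], by linarith [hmem.1]⟩)
  rw [show -s - (sp - s) = -sp by ring] at a2
  rw [← reflect (Kbar d p τ) (ind E) (Kbar_neg d p τ) s sp] at a2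
  have b1 := Kmin_le d hd p hp τ hτ (s - sm) (by linarith)
  have b2 := Kmin_le d hd p hp τ hτ (sp - s) (by linarith)
  unfold rtau
  rw [first_term]
  linarith

/-- One-dimensional lower bound for `r_τ`. -/
theorem statement3 (d : ℕ) (hd : 1 ≤ d) (p : ℝ) (hp : (d : ℝ) + 1 < p) :
    ∃ γ₀ : ℝ, 0 < γ₀ ∧ ∃ γ₁ : ℝ, 0 < γ₁ ∧
      (∀ τ : ℝ, 0 < τ → ∀ E : Set ℝ, MeasurableSet E → ∀ sm s sp : ℝ,
        sm < s → s < sp → AEConstOn E (Set.Ioo sm s) → AEConstOn E (Set.Ioo s sp) →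
        rtau d p τ E sm s sp ≥
          -γ₀ + γ₁ * min ((s - sm) ^ (-(p - d - 1))) τ⁻¹
              + γ₁ * min ((sp - s) ^ (-(p - d - 1))) τ⁻¹) ∧
      ∃ τ₀ : ℝ, 0 < τ₀ ∧ ∃ η₀ : ℝ, 0 < η₀ ∧
        ∀ τ : ℝ, 0 < τ → τ < τ₀ → ∀ E : Set ℝ, MeasurableSet E → ∀ sm s sp : ℝ,
          sm < s → s < sp → AEConstOn E (Set.Ioo sm s) → AEConstOn E (Set.Ioo s sp) →
          min (s - sm) (sp - s) < η₀ →
          rtau d p τ E sm s sp ≥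
            (γ₁ / 2) * min ((s - sm) ^ (-(p - d - 1)))
              (min ((sp - s) ^ (-(p - d - 1))) τ⁻¹) := by
  have hq : 0 < p - d - 1 := by linarith
  obtain ⟨γ₀, hγ₀⟩ : ∃ γ₀ : ℝ, γ₀ = 2 * (1 / (p - d - 1)
      + 2 * (4 : ℝ) ^ (-(p - d - 1) - 2) * 4 ^ (p - d - 1)) := ⟨_, rfl⟩
  obtain ⟨γ₁, hγ₁⟩ : ∃ γ₁ : ℝ, γ₁ = 2 * (4 : ℝ) ^ (-(p - d - 1) - 2) := ⟨_, rfl⟩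
  have g0 : 0 < γ₀ := by rw [hγ₀]; positivity
  have g1 : 0 < γ₁ := by rw [hγ₁]; positivity
  have main : ∀ τ : ℝ, 0 < τ → ∀ E : Set ℝ, MeasurableSet E → ∀ sm s sp : ℝ,
        sm < s → s < sp → AEConstOn E (Set.Ioo sm s) → AEConstOn E (Set.Ioo s sp) →
        rtau d p τ E sm s sp ≥
          -γ₀ + γ₁ * min ((s - sm) ^ (-(p - d - 1))) τ⁻¹
              + γ₁ * min ((sp - s) ^ (-(p - d - 1))) τ⁻¹ := by
    intro τ hτ E _ sm s sp h1 h2 hc1 hc2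
    rw [hγ₀, hγ₁]
    exact rtau_lower d hd p hp τ hτ E sm s sp h1 h2 hc1 hc2
  refine ⟨γ₀, g0, γ₁, g1, main, γ₁ / γ₀, by positivity,
    (γ₀ / γ₁) ^ (-(1 / (p - d - 1))), by positivity, ?_⟩
  intro τ hτ hτ0 E hE sm s sp h1 h2 hc1 hc2 hmin
  have hm := main τ hτ E hE sm s sp h1 h2 hc1 hc2
  have hτi : γ₀ / γ₁ ≤ τ⁻¹ := by
    rw [← inv_div]
    exact inv_anti₀ hτ hτ0.le
  have hpow : ∀ x : ℝ, 0 < x → x < (γ₀ / γ₁) ^ (-(1 / (p - d - 1))) →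
      γ₀ / γ₁ ≤ x ^ (-(p - d - 1)) := by
    intro x hx hxl
    have h3 := Real.rpow_le_rpow_of_nonpos (z := -(p - d - 1)) hx hxl.le (by linarith)
    rwa [← Real.rpow_mul (by positivity), show -(1 / (p - d - 1)) * -(p - d - 1) = 1 by field_simp,
      Real.rpow_one] at h3
  have hX : 0 < (s - sm) ^ (-(p - d - 1)) := Real.rpow_pos_of_pos (by linarith) _
  have hY : 0 < (sp - s) ^ (-(p - d - 1)) := Real.rpow_pos_of_pos (by linarith) _
  have hT : 0 < τ⁻¹ := by positivity
  have hor := min_lt_iff.1 hmin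
  have hor' : γ₀ / γ₁ ≤ (s - sm) ^ (-(p - d - 1)) ∨ γ₀ / γ₁ ≤ (sp - s) ^ (-(p - d - 1)) :=
    hor.imp (hpow _ (by linarith)) (hpow _ (by linarith))
  generalize (s - sm) ^ (-(p - d - 1)) = X at *
  generalize (sp - s) ^ (-(p - d - 1)) = Y at *
  have hg : ∀ Z, γ₀ / γ₁ ≤ Z → γ₀ ≤ γ₁ * min Z τ⁻¹ := by
    intro Z hZ
    have h5 := (div_le_iff₀ g1).1 (le_min hZ hτi)
    linarith
  have hZ0 : 0 ≤ min X (min Y τ⁻¹) := le_min hX.le (le_min hY.le hT.le)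
  have hZ1 : min X (min Y τ⁻¹) ≤ min X τ⁻¹ :=
    min_le_min le_rfl (min_le_right _ _)
  have hZ2 : min X (min Y τ⁻¹) ≤ min Y τ⁻¹ := min_le_right _ _
  have k0 := mul_nonneg g1.le hZ0
  have k1 := mul_le_mul_of_nonneg_left hZ1 g1.le
  have k2 := mul_le_mul_of_nonneg_left hZ2 g1.le
  rcases hor' with h | h
  · have := hg X h
    linarith
  · have := hg Y h
    linarith

end
end

section
/- Let d ≥ 1 be an integer and p > d+1. There exist η₀, τ₀ > 0 and C > 0 depending only on p and d such that the following holds for all 0 < τ < τ₀. Let (F, B_F) be a one-dimensional set of locally finite perimeter and I ⊂ ℝ a bounded open interval with B_F ∩ I = {k₁ < ⋯ < k_m}; assume all mutual distances between points of B_F ∩ I exceed η₀ and that dist(k₁, B_F ∖ I) > η₀ and dist(k_m, B_F ∖ I) > η₀. Let k₀ < k₁ and k_m < k_{m+1} < k_{m+2} be reals outside I such that all mutual distances among k₀, k₁, …, k_{m+2} exceed η₀; set k_max := k_{m+1} if m is odd and k_max := k_{m+2} if m is even, Ĩ := [k₀, k_max), and let (F̃, B_{F̃}) be the (k_max − k₀)-periodic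 one-dimensional set of locally finite perimeter with F̃ ∩ I = F ∩ I and B_{F̃} ∩ [k₀, k_max] = {k₀, k₁, …, k_m} ∪ ({k_{m+1}, k_{m+2}} ∩ [k₀, k_max]). Then: (1) ∑_{s ∈ B_F ∩ I} r_τ(F,s) ≥ ∑_{s ∈ B_{F̃} ∩ Ĩ} r_τ(F̃,s) − C; and (2) for the simple periodic set S̃ with equal widths and gaps h̃ := |Ĩ|/n, where n := #(B_{F̃} ∩ Ĩ) (i.e., S̃ = {t ∈ ℝ : t − c ∈ ⋃_{k∈ℤ} [2k h̃, (2k+1) h̃)} for any choice of c ∈ ℝ), one has ∑_{s ∈ B_{F̃} ∩ Ĩ} r_τ(F̃,s) ≥ ∑_{s ∈ B_{S̃} ∩ [c, c+|Ĩ|)} r_τ(S̃,s). -/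
open MeasureTheory Filter
open scoped ENNReal

noncomputable section

lemma cyc_sum (n : ℕ) (t w : ℕ → ℝ) (ht : ∀ i < n, 0 ≤ t i)
    (h : ∀ i < n, w i + w (i+1) + t i * (w i - w (i+1)) = 2 * t i) (hw : w n = w 0) :
    ∑ i ∈ Finset.range n, w i ≤ ∑ i ∈ Finset.range n, t i := by
  have h1 : ∑ i ∈ Finset.range n, (w i + w (i+1)) ≤
      ∑ i ∈ Finset.range n, (2 * t i + (w (i+1)^2/2 - w i ^2/2)) := by
    apply Finset.sum_le_sum
    intro i hi
    have hi := Finset.mem_range.1 hi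
    have a1 := h i hi
    have a2 := mul_nonneg (ht i hi) (sq_nonneg (w i - w (i+1)))
    have a3 : w i ^ 2 - w (i+1) ^ 2 = 2 * t i * (w i - w (i+1)) - t i * (w i - w (i+1))^2 := by
      have : (w i + w (i+1)) * (w i - w (i+1)) =
        (2 * t i - t i * (w i - w (i+1))) * (w i - w (i+1)) := by rw [← a1]; ring
      linarith
    nlinarith
  have h2 : ∑ i ∈ Finset.range n, w (i+1) = ∑ i ∈ Finset.range n, w i := by
    have := Finset.sum_range_sub w n
    rw [Finset.sum_sub_distrib] at this
    linarith
  rw [Finset.sum_add_distrib, Finset.sum_add_distrib, ← Finset.mul_sum, h2,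
    Finset.sum_range_sub (fun i => w i ^ 2 / 2), hw] at h1
  linarith

def Tf (x : ℝ) : ℝ := (1 - Real.exp (-x)) / (1 + Real.exp (-x))

lemma Tf_concave : ConcaveOn ℝ (Set.Ici 0) Tf := by
  have hd : ∀ x, HasDerivAt Tf (2 * (Real.exp (-x) / (1 + Real.exp (-x))^2)) x := by
    intro x
    have e : HasDerivAt (fun x : ℝ => Real.exp (-x)) (-Real.exp (-x)) x := by
      simpa using (hasDerivAt_neg x).exp
    have hp := Real.exp_pos (-x)
    have := (e.const_sub 1).fun_div (e.const_add 1) (by positivity)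
    refine this.congr_deriv ?_
    field_simp
    ring
  have hde : deriv Tf = fun x => 2 * (Real.exp (-x) / (1 + Real.exp (-x))^2) :=
    funext fun x => (hd x).deriv
  apply AntitoneOn.concaveOn_of_deriv (convex_Ici 0)
  · exact fun x _ => (hd x).continuousAt.continuousWithinAt
  · exact fun x _ => (hd x).differentiableAt.differentiableWithinAt
  · rw [hde, interior_Ici]
    intro x hx y hy hxy
    have hx : 0 < x := hx
    have hy : 0 < y := hy
    have p1 := Real.exp_pos (-x)
    have p2 := Real.exp_pos (-y)
    have l1 : Real.exp (-x) < 1 := by rw [Real.exp_lt_one_iff]; linarith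
    have l2 : Real.exp (-y) ≤ Real.exp (-x) := Real.exp_le_exp.2 (by linarith)
    show 2 * _ ≤ 2 * _
    gcongr 2 * ?_
    rw [div_le_div_iff₀ (by positivity) (by positivity)]
    set a := Real.exp (-x)
    set b := Real.exp (-y)
    have : 0 ≤ (a - b) * (1 - a * b) := by
      apply mul_nonneg (by linarith)
      nlinarith
    nlinarith

lemma Tf_jensen (n : ℕ) (hn : 0 < n) (h : ℕ → ℝ) (hh : ∀ i < n, 0 ≤ h i) :
    ∑ i ∈ Finset.range n, Tf (h i) ≤ n * Tf ((∑ i ∈ Finset.range n, h i) / n) := by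
  have hn' : (0:ℝ) < n := by exact_mod_cast hn
  have := Tf_concave.le_map_sum (t := Finset.range n) (w := fun _ => 1 / (n:ℝ)) (p := h)
    (fun _ _ => by positivity) (by simp; field_simp) (fun i hi => hh i (Finset.mem_range.1 hi))
  simp only [smul_eq_mul, ← Finset.mul_sum] at this
  rw [one_div_mul_eq_div, one_div_mul_eq_div, div_le_iff₀ hn'] at this
  linarith

structure Alt (f : ℝ → ℝ) (L : ℝ) (n : ℕ) (x : ℕ → ℝ) : Prop where
  meas : Measurable f
  val : ∀ u, f u = 1 ∨ f u = -1
  per : ∀ u, f (u + L) = f u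
  npos : 0 < n
  neven : Even n
  gap : ∀ i ≤ n, 1 ≤ x (i+1) - x i
  xn : x n = x 0 + L
  xn1 : x (n+1) = x 1 + L
  alt : ∃ σ : ℝ, (σ = 1 ∨ σ = -1) ∧ ∀ i ≤ n, ∀ᵐ u ∂volume,
    u ∈ Set.Ioo (x i) (x (i+1)) → f u = σ * (-1)^i

def phi (f : ℝ → ℝ) (α u : ℝ) : ℝ := ∫ ρ in Set.Ioi (0:ℝ), f (u + ρ) * Real.exp (-(α * ρ))

lemma int_exp (α : ℝ) (hα : 0 < α) (c : ℝ) :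
    IntegrableOn (fun ρ => Real.exp (-(α * ρ))) (Set.Ioi c) := by
  have := integrableOn_exp_mul_Ioi (a := -α) (by linarith) c
  simpa using this

lemma int_f_exp (f : ℝ → ℝ) (hf : Measurable f) (hb : ∀ u, |f u| ≤ 1) (α : ℝ) (hα : 0 < α)
    (u c : ℝ) : IntegrableOn (fun ρ => f (u + ρ) * Real.exp (-(α * ρ))) (Set.Ioi c) := by
  apply Integrable.mono' (int_exp α hα c)
  · exact Measurable.aestronglyMeasurable (by fun_prop)
  · refine Eventually.of_forall fun ρ => ?_
    rw [Real.norm_eq_abs, abs_mul, abs_of_pos (Real.exp_pos _)]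
    have := Real.exp_pos (-(α * ρ))
    nlinarith [hb (u + ρ)]

lemma phi_step (f : ℝ → ℝ) (hf : Measurable f) (hb : ∀ u, |f u| ≤ 1) (α : ℝ) (hα : 0 < α)
    (u v s : ℝ) (huv : u ≤ v) (hs : ∀ᵐ y ∂volume, y ∈ Set.Ioo u v → f y = s) :
    phi f α u = s * (1 - Real.exp (-(α * (v - u)))) / α
      + Real.exp (-(α * (v - u))) * phi f α v := by
  have hI := int_f_exp f hf hb α hα u
  unfold phi
  have hdec : Set.Ioi (0:ℝ) = Set.Ioc 0 (v - u) ∪ Set.Ioi (v - u) :=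
    (Set.Ioc_union_Ioi_eq_Ioi (by linarith)).symm
  rw [hdec, setIntegral_union (Set.Ioc_disjoint_Ioi le_rfl) measurableSet_Ioi
    ((hI 0).mono_set Set.Ioc_subset_Ioi_self) (hI _), ← hdec]
  congr 1
  · have : ∫ ρ in Set.Ioc 0 (v - u), f (u + ρ) * Real.exp (-(α * ρ)) =
        ∫ ρ in Set.Ioc 0 (v - u), s * Real.exp (-(α * ρ)) := by
      rw [integral_Ioc_eq_integral_Ioo, integral_Ioc_eq_integral_Ioo]
      apply setIntegral_congr_ae measurableSet_Ioo
      have := (measurePreserving_add_left volume u).quasiMeasurePreserving.ae hs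
      filter_upwards [this] with ρ h1 h2
      rw [h1 ⟨by linarith [h2.1], by linarith [h2.2]⟩]
    rw [this, ← intervalIntegral.integral_of_le (by linarith)]
    rw [intervalIntegral.integral_const_mul]
    have e : ∫ ρ in (0:ℝ)..(v-u), Real.exp (-(α * ρ)) = (1 - Real.exp (-(α * (v - u)))) / α := by
      have := intervalIntegral.integral_eq_sub_of_hasDerivAt (a := 0) (b := v - u)
        (f := fun ρ => -Real.exp (-(α * ρ)) / α) (f' := fun ρ => Real.exp (-(α * ρ))) ?_ ?_
      · rw [this]; simp; ring
      · intro ρ _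
        have h1 : HasDerivAt (fun ρ : ℝ => -(α * ρ)) (-α) ρ := by
          simpa using ((hasDerivAt_id' ρ).const_mul α).fun_neg
        refine (h1.exp.fun_neg.div_const α).congr_deriv ?_
        field_simp
      · exact Continuous.intervalIntegrable (by fun_prop) _ _
    rw [e]; ring
  · rw [← integral_const_mul]
    have := (measurePreserving_add_right volume (v - u)).setIntegral_preimage_emb
      (measurableEmbedding_addRight (v - u)) (fun ρ => f (u + ρ) * Real.exp (-(α * ρ)))
      (Set.Ioi (v - u))
    rw [Set.preimage_add_const_Ioi, sub_self] at this
    rw [← this]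
    apply setIntegral_congr_fun measurableSet_Ioi
    intro ρ _
    show f (u + (ρ + (v-u))) * _ = _ * (f (v + ρ) * _)
    rw [show u + (ρ + (v-u)) = v + ρ by ring, show -(α * (ρ + (v-u))) = -(α * (v-u)) + -(α*ρ) by ring,
      Real.exp_add]
    ring

lemma abs_le_one_of_val {f : ℝ → ℝ} (h : ∀ u, f u = 1 ∨ f u = -1) (u : ℝ) : |f u| ≤ 1 := by
  rcases h u with h | h <;> simp [h]

lemma sign_sq {s : ℝ} (h : s = 1 ∨ s = -1) : s * s = 1 := by
  rcases h with h | h <;> simp [h]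

lemma abs_sub_val {a b : ℝ} (ha : a = 1 ∨ a = -1) (hb : b = 1 ∨ b = -1) : |a - b| = 1 - b * a := by
  rcases ha with h | h <;> rcases hb with h' | h' <;> simp [h, h'] <;> norm_num

lemma phi_meas (f : ℝ → ℝ) (hf : Measurable f) (α : ℝ) : StronglyMeasurable (phi f α) := by
  have : StronglyMeasurable (Function.uncurry fun u ρ : ℝ => f (u + ρ) * Real.exp (-(α * ρ))) := by
    apply Measurable.stronglyMeasurable
    unfold Function.uncurry
    fun_prop
  exact this.integral_prod_right

lemma int_exp_val (α : ℝ) (hα : 0 < α) : ∫ ρ in Set.Ioi (0:ℝ), Real.exp (-(α * ρ)) = 1 / α := by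
  have := integral_exp_mul_Ioi (a := -α) (by linarith) 0
  simp at this
  simpa using this

lemma phi_bound (f : ℝ → ℝ) (hb : ∀ u, |f u| ≤ 1) (α : ℝ) (hα : 0 < α) (u : ℝ) :
    |phi f α u| ≤ 1 / α := by
  rw [← int_exp_val α hα, ← Real.norm_eq_abs]
  apply norm_integral_le_of_norm_le (int_exp α hα 0)
  refine Eventually.of_forall fun ρ => ?_
  rw [Real.norm_eq_abs, abs_mul, abs_of_pos (Real.exp_pos _)]
  have := Real.exp_pos (-(α * ρ))
  nlinarith [hb (u + ρ)]

lemma ii_of_bdd {g : ℝ → ℝ} (hg : Measurable g) (C : ℝ) (hC : ∀ u, |g u| ≤ C) (a b : ℝ) :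
    IntervalIntegrable g volume a b := by
  apply (intervalIntegrable_const (c := C)).mono_fun hg.aestronglyMeasurable
  refine Eventually.of_forall fun u => ?_
  show |g u| ≤ |C|
  exact (hC u).trans (le_abs_self _)

lemma Alt.fphi_ii {f : ℝ → ℝ} {L : ℝ} {n : ℕ} {x : ℕ → ℝ} (h : Alt f L n x) (α : ℝ) (hα : 0 < α)
    (a b : ℝ) : IntervalIntegrable (fun u => f u * phi f α u) volume a b := by
  apply ii_of_bdd (h.meas.mul (phi_meas f h.meas α).measurable) (1/α)
  intro u
  show |f u * phi f α u| ≤ _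
  rw [abs_mul]
  have := phi_bound f (abs_le_one_of_val h.val) α hα u
  have h2 := abs_le_one_of_val h.val u
  nlinarith [abs_nonneg (phi f α u), abs_nonneg (f u)]

lemma Alt.piece {f : ℝ → ℝ} {L : ℝ} {n : ℕ} {x : ℕ → ℝ} (h : Alt f L n x) (α : ℝ) (hα : 0 < α)
    (a b s : ℝ) (hab : a ≤ b) (hs1 : s = 1 ∨ s = -1)
    (hs : ∀ᵐ y ∂volume, y ∈ Set.Ioo a b → f y = s) :
    ∫ u in a..b, f u * phi f α u =
      (b - a) / α + (s * phi f α b - 1/α) * (1 - Real.exp (-(α * (b - a)))) / α := by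
  have h1 : ∫ u in a..b, f u * phi f α u =
      ∫ u in a..b, (1/α + (s * phi f α b - 1/α) * Real.exp (-(α * (b - u)))) := by
    rw [intervalIntegral.integral_of_le hab, intervalIntegral.integral_of_le hab,
      integral_Ioc_eq_integral_Ioo, integral_Ioc_eq_integral_Ioo]
    apply setIntegral_congr_ae measurableSet_Ioo
    filter_upwards [hs] with u hu hu2
    rw [hu hu2, phi_step f h.meas (abs_le_one_of_val h.val) α hα u b s hu2.2.le ?_]
    · have := sign_sq hs1
      field_simp
      linear_combination (1 - Real.exp (-(α * (b - u)))) * this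
    · filter_upwards [hs] with y hy hy2
      exact hy ⟨hu2.1.trans hy2.1, hy2.2⟩
  rw [h1, intervalIntegral.integral_add (by simp)
    (Continuous.intervalIntegrable (by fun_prop) _ _), intervalIntegral.integral_const_mul]
  have e : ∫ u in a..b, Real.exp (-(α * (b - u))) = (1 - Real.exp (-(α * (b - a)))) / α := by
    have := intervalIntegral.integral_eq_sub_of_hasDerivAt (a := a) (b := b)
      (f := fun ρ => Real.exp (-(α * (b - ρ))) / α) (f' := fun ρ => Real.exp (-(α * (b - ρ)))) ?_ ?_
    · rw [this]; simp; ring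
    · intro ρ _
      have h1 : HasDerivAt (fun ρ : ℝ => -(α * (b - ρ))) α ρ := by
        simpa using (((hasDerivAt_id' ρ).const_sub b).const_mul α).fun_neg
      refine (h1.exp.div_const α).congr_deriv ?_
      field_simp
    · exact Continuous.intervalIntegrable (by fun_prop) _ _
  rw [e]
  simp
  ring

lemma Alt.A_eq {f : ℝ → ℝ} {L : ℝ} {n : ℕ} {x : ℕ → ℝ} (h : Alt f L n x) (α : ℝ) (hα : 0 < α) :
    ∃ w : ℕ → ℝ, w n = w 0 ∧
      (∀ i < n, w i = (1 - Real.exp (-(α * (x (i+1) - x i)))) -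
        Real.exp (-(α * (x (i+1) - x i))) * w (i+1)) ∧
      ∫ u in (x 0)..(x 0 + L), f u * phi f α u =
        L / α - 2 / α^2 * ∑ i ∈ Finset.range n, w i := by
  obtain ⟨σ, hσ, hal⟩ := h.alt
  have hss := sign_sq hσ
  have hm1 : ∀ i : ℕ, ((-1:ℝ)^i) * (-1)^i = 1 := fun i => by
    rw [← mul_pow]; simp
  have hsi : ∀ i : ℕ, σ * (-1)^i = 1 ∨ σ * (-1)^i = -1 := by
    intro i
    rcases neg_one_pow_eq_or ℝ i with e | e <;> rcases hσ with h | h <;> simp [e, h]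
  let w : ℕ → ℝ := fun j => α * σ * (-1)^j * phi f α (x j)
  have hrec : ∀ i < n, w i = (1 - Real.exp (-(α * (x (i+1) - x i)))) -
        Real.exp (-(α * (x (i+1) - x i))) * w (i+1) := by
    intro i hi
    have := phi_step f h.meas (abs_le_one_of_val h.val) α hα (x i) (x (i+1)) _
      (by linarith [h.gap i hi.le]) (hal i hi.le)
    simp only [w]
    rw [this, pow_succ]
    field_simp
    linear_combination (1 - Real.exp (-(α * (x (i+1) - x i)))) * ((-1)^i * (-1)^i * hss + hm1 i)
  have hcyc : w n = w 0 := by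
    simp only [w]
    rw [h.xn, h.neven.neg_one_pow]
    have : phi f α (x 0 + L) = phi f α (x 0) := by
      unfold phi
      congr 1; ext ρ
      rw [show x 0 + L + ρ = x 0 + ρ + L by ring, h.per]
    rw [this]; simp
  refine ⟨w, hcyc, hrec, ?_⟩
  rw [← h.xn, ← intervalIntegral.sum_integral_adjacent_intervals
    (fun k _ => h.fphi_ii α hα _ _)]
  have hp : ∀ i ∈ Finset.range n, ∫ u in (x i)..(x (i+1)), f u * phi f α u =
      (x (i+1) - x i) / α - 1/α^2 * (w i + w (i+1)) := by
    intro i hi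
    have hi := Finset.mem_range.1 hi
    rw [h.piece α hα _ _ _ (by linarith [h.gap i hi.le]) (hsi i) (hal i hi.le), hrec i hi]
    simp only [w]
    rw [pow_succ]
    field_simp
    ring
  rw [Finset.sum_congr rfl hp, Finset.sum_sub_distrib, ← Finset.sum_div, Finset.sum_range_sub,
    ← Finset.mul_sum, Finset.sum_add_distrib]
  have h2 : ∑ i ∈ Finset.range n, w (i+1) = ∑ i ∈ Finset.range n, w i := by
    have := Finset.sum_range_sub w n
    rw [Finset.sum_sub_distrib] at this
    linarith
  rw [h2, h.xn]
  ring

lemma Alt.A_ge {f g : ℝ → ℝ} {L : ℝ} {n : ℕ} {x y : ℕ → ℝ} (h : Alt f L n x) (hg : Alt g L n y)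
    (hy : ∀ i < n, y (i+1) - y i = L / n) (α : ℝ) (hα : 0 < α) :
    ∫ u in (y 0)..(y 0 + L), g u * phi g α u ≤ ∫ u in (x 0)..(x 0 + L), f u * phi f α u := by
  obtain ⟨w, w0, w1, w2⟩ := h.A_eq α hα
  obtain ⟨v, v0, v1, v2⟩ := hg.A_eq α hα
  rw [w2, v2]
  have hn' : (0:ℝ) < n := by exact_mod_cast h.npos
  suffices hh : ∑ i ∈ Finset.range n, w i ≤ ∑ i ∈ Finset.range n, v i by
    have : 0 ≤ 2 / α^2 := by positivity
    nlinarith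
  have e1 : ∑ i ∈ Finset.range n, v i = n * Tf (α * (L / n)) := by
    have : ∑ i ∈ Finset.range n, v i = ∑ i ∈ Finset.range n,
        ((1 - Real.exp (-(α * (L/n)))) - Real.exp (-(α * (L/n))) * v (i+1)) := by
      apply Finset.sum_congr rfl
      intro i hi
      have hi := Finset.mem_range.1 hi
      rw [v1 i hi, hy i hi]
    rw [Finset.sum_sub_distrib, ← Finset.mul_sum] at this
    have h2 : ∑ i ∈ Finset.range n, v (i+1) = ∑ i ∈ Finset.range n, v i := by
      have := Finset.sum_range_sub v n
      rw [Finset.sum_sub_distrib] at this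
      linarith
    rw [h2] at this
    simp at this
    unfold Tf
    have hep := Real.exp_pos (-(α * (L/n)))
    generalize Real.exp (-(α * (L/n))) = E at *
    field_simp
    linarith
  have e2 := Tf_jensen n h.npos (fun i => α * (x (i+1) - x i))
    (fun i hi => mul_nonneg hα.le (by linarith [h.gap i hi.le]))
  rw [← Finset.mul_sum, Finset.sum_range_sub, h.xn, add_sub_cancel_left, mul_div_assoc] at e2
  rw [e1]
  refine le_trans ?_ e2
  apply cyc_sum
  · intro i hi
    unfold Tf
    have : Real.exp (-(α * (x (i+1) - x i))) ≤ 1 := by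
      rw [Real.exp_le_one_iff]
      have := mul_nonneg hα.le (show 0 ≤ x (i+1) - x i by linarith [h.gap i hi.le])
      linarith
    apply div_nonneg (by linarith)
    positivity
  · intro i hi
    rw [w1 i hi]
    unfold Tf
    have := Real.exp_pos (-(α * (x (i+1) - x i)))
    field_simp
    ring
  · exact w0

def Vf (f : ℝ → ℝ) (a L ρ : ℝ) : ℝ := ∫ u in a..(a + L), |f (u + ρ) - f u|

lemma Vf_neg (f : ℝ → ℝ) (a L : ℝ) (h : ∀ u, f (u + L) = f u) (ρ : ℝ) :
    Vf f a L (-ρ) = Vf f a L ρ := by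
  unfold Vf
  have hp : Function.Periodic (fun u => |f (u + ρ) - f u|) L := by
    intro u
    simp only
    rw [show u + L + ρ = u + ρ + L by ring, h, h]
  have := hp.intervalIntegral_add_eq (a - ρ) a
  rw [← this, show a - ρ + L = (a + L) - ρ by ring, ← intervalIntegral.integral_comp_sub_right]
  congr 1; ext u
  rw [sub_add_cancel, abs_sub_comm, sub_eq_add_neg u ρ]

lemma Alt.V_small {f : ℝ → ℝ} {L : ℝ} {n : ℕ} {x : ℕ → ℝ} (h : Alt f L n x) (ρ : ℝ) (h0 : 0 < ρ)
    (h1 : ρ < 1) : Vf f (x 0) L ρ = 2 * n * ρ := by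
  obtain ⟨σ, hσ, hal⟩ := h.alt
  have hii : ∀ a b, IntervalIntegrable (fun u => |f (u + ρ) - f u|) volume a b := by
    have := h.meas
    intro a b
    apply ii_of_bdd (by fun_prop) 2
    intro u
    rw [abs_abs]
    refine (abs_sub _ _).trans ?_
    linarith [abs_le_one_of_val h.val u, abs_le_one_of_val h.val (u + ρ)]
  unfold Vf
  rw [← h.xn, ← intervalIntegral.sum_integral_adjacent_intervals (fun k _ => hii _ _)]
  have hp : ∀ i ∈ Finset.range n, ∫ u in (x i)..(x (i+1)), |f (u + ρ) - f u| = 2 * ρ := by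
    intro i hi
    have hi := Finset.mem_range.1 hi
    have g1 := h.gap i hi.le
    have g2 := h.gap (i+1) hi
    rw [← intervalIntegral.integral_add_adjacent_intervals (hii (x i) (x (i+1) - ρ)) (hii _ _)]
    have s1 := (measurePreserving_add_right volume ρ).quasiMeasurePreserving.ae (hal i hi.le)
    have s2 := (measurePreserving_add_right volume ρ).quasiMeasurePreserving.ae (hal (i+1) hi)
    have i1 : ∫ u in (x i)..(x (i+1) - ρ), |f (u + ρ) - f u| = ∫ u in (x i)..(x (i+1) - ρ), (0:ℝ) := by
      rw [intervalIntegral.integral_of_le (by linarith), intervalIntegral.integral_of_le (by linarith),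
        integral_Ioc_eq_integral_Ioo, integral_Ioc_eq_integral_Ioo]
      apply setIntegral_congr_ae measurableSet_Ioo
      filter_upwards [hal i hi.le, s1] with u a1 a2 hu
      rw [a1 ⟨hu.1, by linarith [hu.2]⟩, a2 ⟨by linarith [hu.1], by linarith [hu.2]⟩]
      simp
    have i2 : ∫ u in (x (i+1) - ρ)..(x (i+1)), |f (u + ρ) - f u| =
        ∫ u in (x (i+1) - ρ)..(x (i+1)), (2:ℝ) := by
      rw [intervalIntegral.integral_of_le (by linarith), intervalIntegral.integral_of_le (by linarith),
        integral_Ioc_eq_integral_Ioo, integral_Ioc_eq_integral_Ioo]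
      apply setIntegral_congr_ae measurableSet_Ioo
      filter_upwards [hal i hi.le, s2] with u a1 a2 hu
      rw [a1 ⟨by linarith [hu.1], by linarith [hu.2]⟩, a2 ⟨by linarith [hu.1], by linarith [hu.2]⟩]
      rw [pow_succ]
      rcases neg_one_pow_eq_or ℝ i with e | e <;> rcases hσ with h | h <;> simp [e, h] <;> norm_num
    rw [i1, i2]
    simp
    ring
  rw [Finset.sum_congr rfl hp]
  simp
  ring

lemma Alt.V_exp {f : ℝ → ℝ} {L : ℝ} (hL : 0 < L) {n : ℕ} {x : ℕ → ℝ} (h : Alt f L n x) (α : ℝ)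
    (hα : 0 < α) : ∫ ρ in Set.Ioi (0:ℝ), Vf f (x 0) L ρ * Real.exp (-(α * ρ)) =
      L / α - ∫ u in (x 0)..(x 0 + L), f u * phi f α u := by
  have hm := h.meas
  have e1 : ∀ ρ, Vf f (x 0) L ρ * Real.exp (-(α * ρ)) =
      ∫ u in Set.Ioc (x 0) (x 0 + L), (1 - f u * f (u + ρ)) * Real.exp (-(α * ρ)) := by
    intro ρ
    unfold Vf
    rw [intervalIntegral.integral_of_le (by linarith), ← integral_mul_const]
    congr 1; ext u
    rw [abs_sub_val (h.val _) (h.val _)]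
  simp_rw [e1]
  rw [integral_integral_swap]
  · rw [intervalIntegral.integral_of_le (by linarith)]
    have e2 : ∀ u, ∫ ρ in Set.Ioi (0:ℝ), (1 - f u * f (u + ρ)) * Real.exp (-(α * ρ)) =
        1/α - f u * phi f α u := by
      intro u
      unfold phi
      rw [← int_exp_val α hα, ← integral_const_mul, ← integral_sub (int_exp α hα 0)]
      · congr 1; ext ρ; ring
      · exact (int_f_exp f hm (abs_le_one_of_val h.val) α hα u 0).const_mul _
    simp_rw [e2]
    rw [integral_sub (by simp) ((intervalIntegrable_iff_integrableOn_Ioc_of_le (by linarith)).1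
      (h.fphi_ii α hα _ _))]
    simp [hL.le]
    ring
  · have : Integrable (fun z : ℝ × ℝ => Real.exp (-(α * z.1)) * 2)
        ((volume.restrict (Set.Ioi (0:ℝ))).prod (volume.restrict (Set.Ioc (x 0) (x 0 + L)))) :=
      (int_exp α hα 0).mul_prod (g := fun _ => (2:ℝ)) (by simp)
    apply this.mono'
    · apply Measurable.aestronglyMeasurable
      unfold Function.uncurry
      fun_prop
    · refine Eventually.of_forall fun z => ?_
      simp only [Function.uncurry]
      rw [← abs_sub_val (h.val _) (h.val _), Real.norm_eq_abs, abs_mul, abs_abs,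
        abs_of_pos (Real.exp_pos _), mul_comm]
      gcongr
      refine (abs_sub _ _).trans ?_
      linarith [abs_le_one_of_val h.val z.2, abs_le_one_of_val h.val (z.2 + z.1)]

structure KG (K : ℝ → ℝ) (q : ℝ) : Prop where
  even : ∀ ρ, K (-ρ) = K ρ
  nonneg : ∀ ρ, 0 ≤ K ρ
  meas : Measurable K
  int : Integrable K
  tail : ∀ ρ, 1 ≤ ρ → K ρ = ρ ^ (-q)
  hq : 2 < q

def Pf (K f : ℝ → ℝ) (u : ℝ) : ℝ := ∫ ρ in Set.Ioi (0:ℝ), |f (u + ρ) - f u| * K ρ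
def Nf (K f : ℝ → ℝ) (u : ℝ) : ℝ := ∫ ρ in Set.Iio (0:ℝ), |f (u + ρ) - f u| * K ρ

lemma Nf_eq {K : ℝ → ℝ} {q : ℝ} (hK : KG K q) (f : ℝ → ℝ) (u : ℝ) :
    Nf K f u = Pf K (fun v => f (-v)) (-u) := by
  unfold Nf Pf
  have := (Measure.measurePreserving_neg (volume : Measure ℝ)).setIntegral_preimage_emb
    (measurableEmbedding_neg) (fun ρ => |f (u + ρ) - f u| * K ρ) (Set.Iio 0)
  rw [Set.neg_preimage, Set.neg_Iio, neg_zero] at this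
  rw [← this]
  congr 1; ext ρ
  simp only [hK.even, neg_add, neg_neg]

lemma Nf_set {K : ℝ → ℝ} {q : ℝ} (hK : KG K q) (f : ℝ → ℝ) (S : Set ℝ) :
    ∫ u in S, Nf K f u = ∫ u in Neg.neg ⁻¹' S, Pf K (fun v => f (-v)) u := by
  have := (Measure.measurePreserving_neg (volume : Measure ℝ)).setIntegral_preimage_emb
    (measurableEmbedding_neg) (fun u => Nf K f u) S
  rw [← this]
  congr 1; ext u
  rw [Nf_eq hK, neg_neg]

lemma Pf_int {K : ℝ → ℝ} {q : ℝ} (hK : KG K q) {f : ℝ → ℝ} (hf : Measurable f) (C : ℝ)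
    (hb : ∀ u v, |f u - f v| ≤ C) (u : ℝ) : Integrable (fun ρ => |f (u + ρ) - f u| * K ρ) := by
  have := hK.meas
  apply (hK.int.const_mul C).mono' (Measurable.aestronglyMeasurable (by fun_prop))
  refine Eventually.of_forall fun ρ => ?_
  rw [Real.norm_eq_abs, abs_mul, abs_abs, abs_of_nonneg (hK.nonneg ρ)]
  exact mul_le_mul_of_nonneg_right (hb _ _) (hK.nonneg ρ)

lemma Pf_meas {K : ℝ → ℝ} {q : ℝ} (hK : KG K q) {f : ℝ → ℝ} (hf : Measurable f) :
    Measurable (Pf K f) := by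
  have : StronglyMeasurable (Function.uncurry fun u ρ : ℝ => |f (u + ρ) - f u| * K ρ) := by
    apply Measurable.stronglyMeasurable
    have := hK.meas
    unfold Function.uncurry
    fun_prop
  exact this.integral_prod_right.measurable

lemma Pf_nonneg {K : ℝ → ℝ} {q : ℝ} (hK : KG K q) (f : ℝ → ℝ) (u : ℝ) : 0 ≤ Pf K f u :=
  integral_nonneg fun ρ => mul_nonneg (abs_nonneg _) (hK.nonneg ρ)

lemma Pf_le {K : ℝ → ℝ} {q : ℝ} (hK : KG K q) {f : ℝ → ℝ} (hf : Measurable f) (C : ℝ)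
    (hb : ∀ u v, |f u - f v| ≤ C) (u : ℝ) : |Pf K f u| ≤ C * ∫ ρ in Set.Ioi (0:ℝ), K ρ := by
  rw [abs_of_nonneg (Pf_nonneg hK f u), ← integral_const_mul]
  apply integral_mono (Pf_int hK hf C hb u).integrableOn (hK.int.const_mul C).integrableOn
  intro ρ
  exact mul_le_mul_of_nonneg_right (hb _ _) (hK.nonneg ρ)

lemma Pf_ii {K : ℝ → ℝ} {q : ℝ} (hK : KG K q) {f : ℝ → ℝ} (hf : Measurable f) (C : ℝ)
    (hb : ∀ u v, |f u - f v| ≤ C) (a b : ℝ) : IntervalIntegrable (Pf K f) volume a b :=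
  ii_of_bdd (Pf_meas hK hf) _ (Pf_le hK hf C hb) a b

lemma Nf_ii {K : ℝ → ℝ} {q : ℝ} (hK : KG K q) {f : ℝ → ℝ} (hf : Measurable f) (C : ℝ)
    (hb : ∀ u v, |f u - f v| ≤ C) (a b : ℝ) : IntervalIntegrable (Nf K f) volume a b := by
  have : Nf K f = fun u => Pf K (fun v => f (-v)) (-u) := funext fun u => Nf_eq hK f u
  have hf' : Measurable (fun v => f (-v)) := hf.comp measurable_neg
  rw [this]
  exact ii_of_bdd ((Pf_meas hK hf').comp measurable_neg) _
    (fun u => Pf_le hK hf' C (fun u v => hb _ _) (-u)) a b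

lemma PV_swap {K : ℝ → ℝ} {q : ℝ} (hK : KG K q) {f : ℝ → ℝ} (hf : Measurable f) (C : ℝ)
    (hb : ∀ u v, |f u - f v| ≤ C) (a L : ℝ) (hL : 0 < L) (S : Set ℝ) :
    ∫ u in a..(a+L), ∫ ρ in S, |f (u + ρ) - f u| * K ρ = ∫ ρ in S, Vf f a L ρ * K ρ := by
  have := hK.meas
  rw [intervalIntegral.integral_of_le (by linarith), integral_integral_swap]
  · congr 1; ext ρ
    unfold Vf
    rw [intervalIntegral.integral_of_le (by linarith), integral_mul_const]
  · have : Integrable (fun z : ℝ × ℝ => C * K z.2)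
        ((volume.restrict (Set.Ioc a (a + L))).prod (volume.restrict S)) :=
      Integrable.mul_prod (f := fun _ => C) (by simp) hK.int.integrableOn
    apply this.mono'
    · apply Measurable.aestronglyMeasurable
      unfold Function.uncurry
      fun_prop
    · refine Eventually.of_forall fun z => ?_
      simp only [Function.uncurry]
      rw [Real.norm_eq_abs, abs_mul, abs_abs, abs_of_nonneg (hK.nonneg _)]
      exact mul_le_mul_of_nonneg_right (hb _ _) (hK.nonneg _)

lemma PN_total {K : ℝ → ℝ} {q : ℝ} (hK : KG K q) {f : ℝ → ℝ} (hf : Measurable f) (C : ℝ)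
    (hb : ∀ u v, |f u - f v| ≤ C) (a L : ℝ) (hL : 0 < L) (hper : ∀ u, f (u + L) = f u) :
    (∫ u in a..(a+L), Pf K f u) + (∫ u in a..(a+L), Nf K f u) =
      2 * ∫ ρ in Set.Ioi (0:ℝ), Vf f a L ρ * K ρ := by
  unfold Pf Nf
  rw [PV_swap hK hf C hb a L hL, PV_swap hK hf C hb a L hL]
  have := (Measure.measurePreserving_neg (volume : Measure ℝ)).setIntegral_preimage_emb
    (measurableEmbedding_neg) (fun ρ => Vf f a L ρ * K ρ) (Set.Iio 0)
  rw [Set.neg_preimage, Set.neg_Iio, neg_zero] at this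
  rw [← this]
  simp_rw [Vf_neg f a L hper, hK.even]
  ring

lemma Vf_meas {f : ℝ → ℝ} (hf : Measurable f) (a L : ℝ) (hL : 0 < L) : Measurable (Vf f a L) := by
  have : StronglyMeasurable (Function.uncurry fun ρ u : ℝ => |f (u + ρ) - f u|) := by
    apply Measurable.stronglyMeasurable
    unfold Function.uncurry
    fun_prop
  have h2 : Vf f a L = fun ρ => ∫ u in Set.Ioc a (a+L), |f (u + ρ) - f u| := by
    ext ρ
    exact intervalIntegral.integral_of_le (by linarith)
  rw [h2]
  exact this.integral_prod_right.measurable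

lemma Vf_bd {f : ℝ → ℝ} (C : ℝ)
    (hb : ∀ u v, |f u - f v| ≤ C) (a L : ℝ) (hL : 0 < L) (ρ : ℝ) : |Vf f a L ρ| ≤ C * L := by
  unfold Vf
  have := intervalIntegral.norm_integral_le_of_norm_le_const (a := a) (b := a + L) (C := C)
    (f := fun u => |f (u + ρ) - f u|) (fun u _ => by simpa using hb _ _)
  simpa [abs_of_pos hL] using this

lemma V_compare {K : ℝ → ℝ} {q : ℝ} (hK : KG K q) {f g : ℝ → ℝ} {L : ℝ} (hL : 0 < L) {n : ℕ}
    {x y : ℕ → ℝ} (h : Alt f L n x) (hg : Alt g L n y)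
    (hy : ∀ i < n, y (i+1) - y i = L / n) :
    ∫ ρ in Set.Ioi (0:ℝ), Vf f (x 0) L ρ * K ρ ≤ ∫ ρ in Set.Ioi (0:ℝ), Vf g (y 0) L ρ * K ρ := by
  have hbb : ∀ {k : ℝ → ℝ}, (∀ u, k u = 1 ∨ k u = -1) → ∀ u v, |k u - k v| ≤ 2 := by
    intro k hk u v
    refine (abs_sub _ _).trans ?_
    linarith [abs_le_one_of_val hk u, abs_le_one_of_val hk v]
  have mf := Vf_meas h.meas (x 0) L hL
  have mg := Vf_meas hg.meas (y 0) L hL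
  have bf := Vf_bd 2 (hbb h.val) (x 0) L hL
  have bg := Vf_bd 2 (hbb hg.val) (y 0) L hL
  have hIK : ∀ (V : ℝ → ℝ), Measurable V → (∀ ρ, |V ρ| ≤ 2 * L) → Integrable (fun ρ => V ρ * K ρ) := by
    intro V hV hb
    have := hK.meas
    apply (hK.int.const_mul (2*L)).mono' (Measurable.aestronglyMeasurable (by fun_prop))
    refine Eventually.of_forall fun ρ => ?_
    rw [Real.norm_eq_abs, abs_mul, abs_of_nonneg (hK.nonneg ρ)]
    exact mul_le_mul_of_nonneg_right (hb _) (hK.nonneg ρ)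
  have hIE : ∀ (V : ℝ → ℝ), Measurable V → (∀ ρ, |V ρ| ≤ 2 * L) → ∀ α > 0,
      IntegrableOn (fun ρ => V ρ * Real.exp (-(α * ρ))) (Set.Ioi 0) := by
    intro V hV hb α hα
    apply ((int_exp α hα 0).const_mul (2*L)).mono' (Measurable.aestronglyMeasurable (by fun_prop))
    refine Eventually.of_forall fun ρ => ?_
    rw [Real.norm_eq_abs, abs_mul, abs_of_pos (Real.exp_pos _)]
    exact mul_le_mul_of_nonneg_right (hb _) (Real.exp_pos _).le
  let D : ℝ → ℝ := fun ρ => Vf g (y 0) L ρ - Vf f (x 0) L ρ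
  have hDm : Measurable D := mg.sub mf
  rw [← sub_nonneg, ← integral_sub (hIK _ mg bg).integrableOn (hIK _ mf bf).integrableOn]
  have hKq : ∀ ρ ∈ Set.Ioi (0:ℝ), Vf g (y 0) L ρ * K ρ - Vf f (x 0) L ρ * K ρ = D ρ * (1/ρ)^q := by
    intro ρ hρ
    have hρ : 0 < ρ := hρ
    simp only [D]
    by_cases h1 : ρ < 1
    · rw [h.V_small ρ hρ h1, hg.V_small ρ hρ h1]; simp
    · rw [hK.tail ρ (not_lt.1 h1), Real.rpow_neg hρ.le, one_div, Real.inv_rpow hρ.le]; ring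
  have hInt : IntegrableOn (fun ρ => D ρ * (1/ρ)^q) (Set.Ioi 0) :=
    (IntegrableOn.congr_fun ((hIK _ mg bg).sub (hIK _ mf bf)).integrableOn hKq measurableSet_Ioi)
  rw [setIntegral_congr_fun measurableSet_Ioi hKq]
  have hq0 : 0 < q := by linarith [hK.hq]
  have hG := Real.Gamma_pos_of_pos hq0
  have key : Real.Gamma q * ∫ ρ in Set.Ioi (0:ℝ), D ρ * (1/ρ)^q =
      ∫ α in Set.Ioi (0:ℝ), ∫ ρ in Set.Ioi (0:ℝ), D ρ * (α^(q-1) * Real.exp (-(ρ * α))) := by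
    rw [← integral_integral_swap, ← integral_const_mul]
    · apply setIntegral_congr_fun measurableSet_Ioi
      intro ρ hρ
      simp only
      rw [integral_const_mul, Real.integral_rpow_mul_exp_neg_mul_Ioi hq0 hρ]
      ring
    · rw [integrable_prod_iff]
      · constructor
        · filter_upwards [ae_restrict_mem measurableSet_Ioi] with ρ hρ
          simp only [Function.uncurry]
          apply Integrable.const_mul
          by_contra hc
          have e := Real.integral_rpow_mul_exp_neg_mul_Ioi hq0 hρ
          rw [integral_undef hc] at e
          have : 0 < (1/ρ)^q * Real.Gamma q := mul_pos (Real.rpow_pos_of_pos (one_div_pos.2 hρ) _) hG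
          linarith
        · apply (hInt.norm.mul_const (Real.Gamma q)).congr
          filter_upwards [ae_restrict_mem measurableSet_Ioi] with ρ hρ
          simp only [Function.uncurry]
          have e : ∀ α ∈ Set.Ioi (0:ℝ), ‖D ρ * (α^(q-1) * Real.exp (-(ρ * α)))‖ =
              ‖D ρ‖ * (α^(q-1) * Real.exp (-(ρ * α))) := by
            intro α hα
            have hα : 0 < α := hα
            rw [norm_mul, Real.norm_of_nonneg (r := _ * _) (by positivity)]
          rw [setIntegral_congr_fun measurableSet_Ioi e, integral_const_mul,
            Real.integral_rpow_mul_exp_neg_mul_Ioi hq0 hρ, norm_mul,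
            Real.norm_of_nonneg (Real.rpow_nonneg (one_div_pos.2 hρ).le _)]
          ring
      · apply Measurable.aestronglyMeasurable
        unfold Function.uncurry
        fun_prop
  have key2 : 0 ≤ ∫ α in Set.Ioi (0:ℝ), ∫ ρ in Set.Ioi (0:ℝ),
      D ρ * (α^(q-1) * Real.exp (-(ρ * α))) := by
    apply setIntegral_nonneg measurableSet_Ioi
    intro α hα
    have hα : 0 < α := hα
    have e : ∀ ρ, D ρ * (α^(q-1) * Real.exp (-(ρ * α))) =
        α^(q-1) * (Vf g (y 0) L ρ * Real.exp (-(α * ρ)) - Vf f (x 0) L ρ * Real.exp (-(α * ρ))) := by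
      intro ρ
      simp only [D]
      rw [mul_comm ρ α]; ring
    simp_rw [e]
    rw [integral_const_mul, integral_sub (hIE _ mg bg α hα) (hIE _ mf bf α hα),
      h.V_exp hL α hα, hg.V_exp hL α hα]
    apply mul_nonneg (by positivity)
    linarith [h.A_ge hg hy α hα]
  rw [← key] at key2
  exact nonneg_of_mul_nonneg_right key2 hG

def gq (q t : ℝ) : ℝ := t ^ (-(q-1)) / (q-1)

lemma tail_int {K : ℝ → ℝ} {q : ℝ} (hK : KG K q) (t : ℝ) (ht : 1 ≤ t) :
    ∫ ρ in Set.Ioi (0:ℝ), (Set.Ici t).indicator K ρ = gq q t := by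
  have hq := hK.hq
  rw [setIntegral_indicator measurableSet_Ici,
    show Set.Ioi (0:ℝ) ∩ Set.Ici t = Set.Ici t from
      Set.inter_eq_right.2 (fun ρ (hρ : t ≤ ρ) => show 0 < ρ by linarith), integral_Ici_eq_integral_Ioi,
    setIntegral_congr_fun measurableSet_Ioi (fun ρ (hρ : t < ρ) => hK.tail ρ (by linarith)),
    integral_Ioi_rpow_of_lt (by linarith) (by linarith)]
  unfold gq
  rw [show -q + 1 = -(q-1) by ring, neg_div_neg_eq]

lemma gq_int (q : ℝ) (hq : 2 < q) : IntegrableOn (gq q) (Set.Ioi 1) := by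
  unfold gq
  exact (integrableOn_Ioi_rpow_of_lt (by linarith) one_pos).div_const _

lemma gq_val (q : ℝ) (hq : 2 < q) : ∫ t in Set.Ioi (1:ℝ), gq q t = 1 / ((q-1)*(q-2)) := by
  unfold gq
  rw [integral_div, integral_Ioi_rpow_of_lt (by linarith) one_pos]
  rw [Real.one_rpow]
  have : q - 1 ≠ 0 := by linarith
  have : q - 2 ≠ 0 := by linarith
  have : -(q-1)+1 ≠ 0 := by linarith
  field_simp
  ring

lemma gq_nonneg (q : ℝ) (hq : 2 < q) (t : ℝ) (ht : 0 ≤ t) : 0 ≤ gq q t := by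
  unfold gq
  exact div_nonneg (Real.rpow_nonneg ht _) (by linarith)

lemma gq_refl (q : ℝ) (hq : 2 < q) (z : ℝ) :
    IntegrableOn (fun u => gq q (z - u)) (Set.Iio (z - 1)) ∧
    ∫ u in Set.Iio (z - 1), gq q (z - u) = 1 / ((q-1)*(q-2)) := by
  have mp := Measure.measurePreserving_sub_left (volume : Measure ℝ) z
  have me := (Homeomorph.subLeft z).measurableEmbedding
  have hpre : (fun u => z - u) ⁻¹' (Set.Ioi 1) = Set.Iio (z - 1) := by
    ext u; simp only [Set.mem_preimage, Set.mem_Ioi, Set.mem_Iio]; constructor <;> intro h <;> linarith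
  constructor
  · rw [← hpre]
    exact (mp.integrableOn_comp_preimage me).2 (gq_int q hq)
  · rw [← gq_val q hq, ← mp.setIntegral_preimage_emb me (gq q) (Set.Ioi 1), hpre]

lemma left_lemma {K : ℝ → ℝ} {q : ℝ} (hK : KG K q) {f g : ℝ → ℝ} (hf : Measurable f)
    (hg : Measurable g) (bf : ∀ u v, |f u - f v| ≤ 1) (bg : ∀ u v, |g u - g v| ≤ 1)
    (z1 zm : ℝ) (hz : z1 ≤ zm) (A : Set ℝ) (hAm : MeasurableSet A)
    (hA1 : Set.Ioo (z1-1) z1 ⊆ A) (hA2 : A ⊆ Set.Iio z1)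
    (hc : ∀ᵐ u ∂volume, u ∈ A → ∀ᵐ v ∂volume, v ∈ Set.Ioo u z1 → f v = f u)
    (hfg : ∀ᵐ u ∂volume, u ∈ Set.Ioo (z1-1) (zm+1) → f u = g u) (y : ℝ) (hy : y ≤ z1 - 1) :
    (∫ u in A, Pf K f u) + ∫ u in z1..zm, Pf K f u ≤
      (∫ u in Set.Ioo y z1, Pf K g u) + (∫ u in z1..zm, Pf K g u) + 2 * (1 / ((q-1)*(q-2))) := by
  have hq := hK.hq
  have iK : ∀ t, IntegrableOn ((Set.Ici t).indicator K) (Set.Ioi 0) := fun t =>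
    (hK.int.indicator measurableSet_Ici).integrableOn
  -- bound on the middle part
  have S1 : ∀ᵐ u ∂volume, u ∈ Set.Ioo (z1-1) zm → Pf K f u ≤ Pf K g u + gq q (zm + 1 - u) := by
    filter_upwards [hfg] with u hu hum
    have hu := hu ⟨hum.1, by linarith [hum.2]⟩
    rw [← tail_int hK (zm + 1 - u) (by linarith [hum.2])]
    unfold Pf
    rw [← integral_add (Pf_int hK hg 1 bg u).integrableOn (iK _)]
    apply setIntegral_mono_ae_restrict (Pf_int hK hf 1 bf u).integrableOn
      ((Pf_int hK hg 1 bg u).integrableOn.add (iK _))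
    have := (measurePreserving_add_left volume u).quasiMeasurePreserving.ae hfg
    rw [EventuallyLE, ae_restrict_iff' measurableSet_Ioi]
    filter_upwards [this] with ρ hρ hρ0
    have hρ0 : 0 < ρ := hρ0
    simp only [Pi.add_apply]
    by_cases hlt : ρ < zm + 1 - u
    · rw [hρ ⟨by linarith [hum.1], by linarith⟩, hu, Set.indicator_of_notMem (show ρ ∉ Set.Ici _ from not_le.2 hlt)]
      simp
    · rw [Set.indicator_of_mem (show ρ ∈ Set.Ici _ from not_lt.1 hlt)]
      have h1 := mul_le_mul_of_nonneg_right (bf (u+ρ) u) (hK.nonneg ρ)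
      have h2 := mul_nonneg (abs_nonneg (g (u+ρ) - g u)) (hK.nonneg ρ)
      linarith
  have S2 : ∀ᵐ u ∂volume, u ∈ A ∩ Set.Iio (z1 - 1) → Pf K f u ≤ gq q (z1 - u) := by
    filter_upwards [hc] with u hu hum
    have hu := hu hum.1
    have hul : u < z1 - 1 := hum.2
    rw [← tail_int hK (z1 - u) (by linarith)]
    unfold Pf
    apply setIntegral_mono_ae_restrict (Pf_int hK hf 1 bf u).integrableOn (iK _)
    have := (measurePreserving_add_left volume u).quasiMeasurePreserving.ae hu
    rw [EventuallyLE, ae_restrict_iff' measurableSet_Ioi]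
    filter_upwards [this] with ρ hρ hρ0
    have hρ0 : 0 < ρ := hρ0
    by_cases hlt : ρ < z1 - u
    · rw [hρ ⟨by linarith, by linarith⟩, Set.indicator_of_notMem (show ρ ∉ Set.Ici _ from not_le.2 hlt)]
      simp
    · rw [Set.indicator_of_mem (show ρ ∈ Set.Ici _ from not_lt.1 hlt)]
      have h1 := mul_le_mul_of_nonneg_right (bf (u+ρ) u) (hK.nonneg ρ)
      linarith
  have iPf := Pf_ii hK hf 1 bf
  have iPg := Pf_ii hK hg 1 bg
  obtain ⟨r1, r2⟩ := gq_refl q hq z1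
  obtain ⟨r3, r4⟩ := gq_refl q hq (zm + 1)
  have hAI : IntegrableOn (Pf K f) (A ∩ Set.Iio (z1-1)) := by
    apply Integrable.mono' (r1.mono_set Set.inter_subset_right)
      (Pf_meas hK hf).aestronglyMeasurable
    rw [ae_restrict_iff' (hAm.inter measurableSet_Iio)]
    filter_upwards [S2] with u hu hum
    rw [Real.norm_of_nonneg (Pf_nonneg hK f u)]
    exact hu hum
  have B1 : ∫ u in A ∩ Set.Iio (z1-1), Pf K f u ≤ 1 / ((q-1)*(q-2)) := by
    calc _ ≤ ∫ u in A ∩ Set.Iio (z1-1), gq q (z1 - u) :=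
          setIntegral_mono_on_ae hAI (r1.mono_set Set.inter_subset_right)
            (hAm.inter measurableSet_Iio) S2
      _ ≤ ∫ u in Set.Iio (z1-1), gq q (z1 - u) := by
          apply setIntegral_mono_set r1
          · rw [EventuallyLE, ae_restrict_iff' measurableSet_Iio]
            refine Eventually.of_forall fun u (hu : u < z1 - 1) => gq_nonneg q hq _ (by linarith)
          · exact Set.inter_subset_right.eventuallyLE
      _ = _ := r2
  have hAd : ∫ u in A, Pf K f u = (∫ u in A ∩ Set.Iio (z1-1), Pf K f u) +
      ∫ u in (z1-1)..z1, Pf K f u := by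
    rw [intervalIntegral.integral_of_le (by linarith), integral_Ioc_eq_integral_Ioo,
      ← integral_Ico_eq_integral_Ioo, ← setIntegral_union ?_ measurableSet_Ico hAI ?_]
    · have : (A : Set ℝ) =ᵐ[volume] (A ∩ Set.Iio (z1-1) ∪ Set.Ico (z1-1) z1 : Set ℝ) := by
        have : ∀ᵐ u : ℝ ∂volume, u ≠ z1 - 1 := by simp [ae_iff]
        filter_upwards [this] with u hu
        apply propext
        show u ∈ A ↔ u ∈ (A ∩ Set.Iio (z1-1) ∪ Set.Ico (z1-1) z1)
        constructor
        · intro h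
          by_cases h2 : u < z1 - 1
          · exact Or.inl ⟨h, h2⟩
          · exact Or.inr ⟨not_lt.1 h2, hA2 h⟩
        · rintro (h | h)
          · exact h.1
          · exact hA1 ⟨lt_of_le_of_ne h.1 (Ne.symm hu), h.2⟩
      exact setIntegral_congr_set this
    · rw [Set.disjoint_left]
      rintro u ⟨_, h⟩ h2
      exact absurd h2.1 (not_le.2 h)
    · rw [integrableOn_Ico_iff_integrableOn_Ioo, ← integrableOn_Ioc_iff_integrableOn_Ioo]
      exact (intervalIntegrable_iff_integrableOn_Ioc_of_le (by linarith)).1 (iPf _ _)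
  have ig : IntegrableOn (fun u => gq q (zm + 1 - u)) (Set.Ioo (z1-1) zm) :=
    r3.mono_set (fun u hu => by show u < zm + 1 - 1; linarith [hu.2])
  have B2 : ∫ u in (z1-1)..zm, Pf K f u ≤ (∫ u in (z1-1)..zm, Pf K g u) + 1 / ((q-1)*(q-2)) := by
    have ioo : ∀ {h : ℝ → ℝ}, IntervalIntegrable h volume (z1-1) zm →
        IntegrableOn h (Set.Ioo (z1-1) zm) := fun hh => by
      rw [← integrableOn_Ioc_iff_integrableOn_Ioo]
      exact (intervalIntegrable_iff_integrableOn_Ioc_of_le (by linarith)).1 hh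
    rw [intervalIntegral.integral_of_le (by linarith), integral_Ioc_eq_integral_Ioo,
      intervalIntegral.integral_of_le (by linarith), integral_Ioc_eq_integral_Ioo]
    calc _ ≤ ∫ u in Set.Ioo (z1-1) zm, (Pf K g u + gq q (zm + 1 - u)) :=
          setIntegral_mono_on_ae (ioo (iPf _ _)) ((ioo (iPg _ _)).add ig) measurableSet_Ioo S1
      _ = (∫ u in Set.Ioo (z1-1) zm, Pf K g u) + ∫ u in Set.Ioo (z1-1) zm, gq q (zm + 1 - u) :=
          integral_add (ioo (iPg _ _)) ig
      _ ≤ _ := by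
          gcongr
          rw [← r4]
          apply setIntegral_mono_set r3
          · rw [EventuallyLE, ae_restrict_iff' measurableSet_Iio]
            refine Eventually.of_forall fun u (hu : u < zm + 1 - 1) => gq_nonneg q hq _ (by linarith)
          · apply LE.le.eventuallyLE
            intro u hu
            show u < zm + 1 - 1
            linarith [hu.2]
  have B3 : ∫ u in (z1-1)..z1, Pf K g u ≤ ∫ u in Set.Ioo y z1, Pf K g u := by
    rw [intervalIntegral.integral_of_le (by linarith), integral_Ioc_eq_integral_Ioo]
    apply setIntegral_mono_set
    · rw [← integrableOn_Ioc_iff_integrableOn_Ioo]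
      exact (intervalIntegrable_iff_integrableOn_Ioc_of_le (by linarith)).1 (iPg _ _)
    · exact Eventually.of_forall fun u => Pf_nonneg hK g u
    · exact (Set.Ioo_subset_Ioo_left hy).eventuallyLE
  rw [hAd]
  rw [← intervalIntegral.integral_add_adjacent_intervals (iPf (z1-1) z1) (iPf z1 zm),
    ← intervalIntegral.integral_add_adjacent_intervals (iPg (z1-1) z1) (iPg z1 zm)] at B2
  linarith

lemma left_ge {K : ℝ → ℝ} {q : ℝ} (hK : KG K q) {f : ℝ → ℝ} (hf : Measurable f)
    (bf : ∀ u v, |f u - f v| ≤ 1) (s y c1 c2 : ℝ) (hy : y ≤ s - 1)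
    (h1 : ∀ᵐ u ∂volume, u ∈ Set.Ioo (s-1) s → f u = c1)
    (h2 : ∀ᵐ u ∂volume, u ∈ Set.Ioo s (s+1) → f u = c2) (hc : |c2 - c1| = 1) :
    ∫ ρ in Set.Ioo (0:ℝ) 1, ρ * K ρ ≤ ∫ u in Set.Ioo y s, Pf K f u := by
  have hKm := hK.meas
  have iPf := Pf_ii hK hf 1 bf
  have ioo : IntegrableOn (Pf K f) (Set.Ioo y s) := by
    rw [← integrableOn_Ioc_iff_integrableOn_Ioo]
    exact (intervalIntegrable_iff_integrableOn_Ioc_of_le (by linarith)).1 (iPf _ _)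
  have hsub : Set.Ioo (s-1) s ⊆ Set.Ioo y s := Set.Ioo_subset_Ioo_left hy
  have hI : Integrable (Function.uncurry fun ρ u : ℝ => (Set.Ioi (s - ρ)).indicator (fun _ => K ρ) u)
      ((volume.restrict (Set.Ioo (0:ℝ) 1)).prod (volume.restrict (Set.Ioo (s-1) s))) := by
    have : Integrable (fun z : ℝ × ℝ => K z.1 * 1)
        ((volume.restrict (Set.Ioo (0:ℝ) 1)).prod (volume.restrict (Set.Ioo (s-1) s))) :=
      Integrable.mul_prod (g := fun _ => (1:ℝ)) hK.int.integrableOn (by simp)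
    apply this.mono'
    · apply Measurable.aestronglyMeasurable
      have : (Function.uncurry fun ρ u : ℝ => (Set.Ioi (s - ρ)).indicator (fun _ => K ρ) u) =
          Set.indicator {z : ℝ × ℝ | s - z.1 < z.2} (fun z => K z.1) := by
        ext z
        simp only [Function.uncurry, Set.indicator, Set.mem_Ioi, Set.mem_ofPred_eq]
      rw [this]
      apply Measurable.indicator (by fun_prop)
      exact measurableSet_lt (by fun_prop) (by fun_prop)
    · refine Eventually.of_forall fun z => ?_
      simp only [Function.uncurry, mul_one]
      rw [Real.norm_eq_abs]
      by_cases hz : z.2 ∈ Set.Ioi (s - z.1)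
      · rw [Set.indicator_of_mem hz, abs_of_nonneg (hK.nonneg _)]
      · rw [Set.indicator_of_notMem hz, abs_zero]; exact hK.nonneg _
  calc ∫ ρ in Set.Ioo (0:ℝ) 1, ρ * K ρ
      = ∫ ρ in Set.Ioo (0:ℝ) 1, ∫ u in Set.Ioo (s-1) s,
          (Set.Ioi (s - ρ)).indicator (fun _ => K ρ) u := by
        apply setIntegral_congr_fun measurableSet_Ioo
        intro ρ hρ
        simp only
        rw [setIntegral_indicator measurableSet_Ioi]
        have : Set.Ioo (s-1) s ∩ Set.Ioi (s-ρ) = Set.Ioo (s-ρ) s := by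
          ext u
          simp only [Set.mem_inter_iff, Set.mem_Ioo, Set.mem_Ioi]
          constructor
          · rintro ⟨⟨a, b⟩, c⟩; exact ⟨c, b⟩
          · rintro ⟨a, b⟩; exact ⟨⟨by linarith [hρ.2], b⟩, a⟩
        rw [this]
        simp [hρ.1.le]
    _ = ∫ u in Set.Ioo (s-1) s, ∫ ρ in Set.Ioo (0:ℝ) 1,
          (Set.Ioi (s - ρ)).indicator (fun _ => K ρ) u := integral_integral_swap hI
    _ ≤ ∫ u in Set.Ioo (s-1) s, Pf K f u := by
        apply setIntegral_mono_on_ae (f := fun u => ∫ ρ in Set.Ioo (0:ℝ) 1,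
          (Set.Ioi (s - ρ)).indicator (fun _ => K ρ) u) hI.swap.integral_prod_left (ioo.mono_set hsub) measurableSet_Ioo
        filter_upwards [h1] with u hu hum
        have hu := hu hum
        unfold Pf
        rw [← integral_indicator measurableSet_Ioo, ← integral_indicator measurableSet_Ioi]
        apply integral_mono_of_nonneg
        · refine Eventually.of_forall fun ρ => ?_
          apply Set.indicator_nonneg
          intro ρ _
          apply Set.indicator_nonneg
          intro _ _
          exact hK.nonneg ρ
        · exact (Pf_int hK hf 1 bf u).indicator measurableSet_Ioi
        · have := (measurePreserving_add_left volume u).quasiMeasurePreserving.ae h2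
          filter_upwards [this] with ρ hρ
          by_cases hm : ρ ∈ Set.Ioo (0:ℝ) 1
          · rw [Set.indicator_of_mem hm, Set.indicator_of_mem (show ρ ∈ Set.Ioi (0:ℝ) from hm.1)]
            by_cases hm2 : u ∈ Set.Ioi (s - ρ)
            · have hm3 : s - ρ < u := hm2
              rw [Set.indicator_of_mem hm2, hρ ⟨by linarith, by linarith [hum.2, hm.2]⟩, hu, hc, one_mul]
            · rw [Set.indicator_of_notMem hm2]
              exact mul_nonneg (abs_nonneg _) (hK.nonneg _)
          · rw [Set.indicator_of_notMem hm]
            apply Set.indicator_nonneg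
            intro ρ _
            exact mul_nonneg (abs_nonneg _) (hK.nonneg _)
    _ ≤ _ := by
        apply setIntegral_mono_set ioo
        · exact Eventually.of_forall fun u => Pf_nonneg hK f u
        · exact hsub.eventuallyLE

lemma cst_eq {K : ℝ → ℝ} {q : ℝ} (hK : KG K q) :
    ∫ ρ in Set.Ioo (-1:ℝ) 1, |ρ| * K ρ = 2 * ∫ ρ in Set.Ioo (0:ℝ) 1, ρ * K ρ := by
  have hKm := hK.meas
  have hi : ∀ a b, -1 ≤ a → a ≤ b → b ≤ 1 → IntervalIntegrable (fun ρ => |ρ| * K ρ) volume a b := by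
    intro a b h1 h2 h3
    rw [intervalIntegrable_iff_integrableOn_Ioc_of_le h2]
    apply Integrable.mono' hK.int.integrableOn (Measurable.aestronglyMeasurable (by fun_prop))
    rw [ae_restrict_iff' measurableSet_Ioc]
    refine Eventually.of_forall fun ρ hρ => ?_
    rw [Real.norm_of_nonneg (mul_nonneg (abs_nonneg _) (hK.nonneg _))]
    have : |ρ| ≤ 1 := abs_le.2 ⟨by linarith [hρ.1], by linarith [hρ.2]⟩
    nlinarith [hK.nonneg ρ]
  rw [← integral_Ioc_eq_integral_Ioo, ← integral_Ioc_eq_integral_Ioo,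
    ← intervalIntegral.integral_of_le (by norm_num), ← intervalIntegral.integral_of_le (by norm_num),
    ← intervalIntegral.integral_add_adjacent_intervals (hi (-1) 0 (by norm_num) (by norm_num) (by norm_num))
      (hi 0 1 (by norm_num) (by norm_num) (by norm_num))]
  have e1 : ∫ ρ in (-1:ℝ)..0, |ρ| * K ρ = ∫ ρ in (0:ℝ)..1, |ρ| * K ρ := by
    have := intervalIntegral.integral_comp_neg (a := 0) (b := 1) (fun ρ => |ρ| * K ρ)
    simp only [abs_neg, hK.even, neg_zero] at this
    exact this.symm
  have e2 : ∫ ρ in (0:ℝ)..1, |ρ| * K ρ = ∫ ρ in (0:ℝ)..1, ρ * K ρ := by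
    apply intervalIntegral.integral_congr
    intro ρ hρ
    rw [Set.uIcc_of_le (by norm_num)] at hρ
    simp only [abs_of_nonneg hρ.1]
  rw [e1, e2]; ring

lemma Kbar_KG (d : ℕ) (hd : 1 ≤ d) (p : ℝ) (hp : (d : ℝ) + 1 < p) (τ : ℝ) (h0 : 0 < τ) (h1 : τ < 1) :
    KG (Kbar d p τ) (p - d + 1) := by
  have hd' : (1:ℝ) ≤ d := by exact_mod_cast hd
  set ε := τ ^ (1 / (p - d - 1)) with hε
  have e0 : 0 < ε := Real.rpow_pos_of_pos h0 _
  have e1 : ε < 1 := Real.rpow_lt_one h0.le h1 (by apply one_div_pos.2; linarith)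
  have hev : ∀ ρ, Kbar d p τ (-ρ) = Kbar d p τ ρ := by intro ρ; unfold Kbar; rw [abs_neg]
  have hnn : ∀ ρ, 0 ≤ Kbar d p τ ρ := by
    intro ρ; unfold Kbar; positivity
  have hm : Measurable (Kbar d p τ) := by
    have ha : Measurable (fun ρ : ℝ => |ρ|) := measurable_id.abs
    unfold Kbar
    exact (ha.pow_const _).mul ((measurable_const.max ha).pow_const _)
  have ht : ∀ ρ, 1 ≤ ρ → Kbar d p τ ρ = ρ ^ (-(p - d + 1)) := by
    intro ρ hρ
    unfold Kbar
    rw [← hε, abs_of_nonneg (by linarith), max_eq_right (by linarith), ← Real.rpow_add (by linarith)]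
    congr 1; ring
  have i1 : IntegrableOn (Kbar d p τ) (Set.Ioc 0 1) := by
    apply Integrable.mono' (g := fun _ => ε ^ (-p)) (by simp) hm.aestronglyMeasurable
    rw [ae_restrict_iff' measurableSet_Ioc]
    refine Eventually.of_forall fun ρ hρ => ?_
    rw [Real.norm_of_nonneg (hnn ρ)]
    unfold Kbar
    rw [← hε, abs_of_pos hρ.1]
    have a1 : ρ ^ ((d:ℝ) - 1) ≤ 1 := Real.rpow_le_one hρ.1.le hρ.2 (by linarith)
    have a2 : (max ε ρ) ^ (-p) ≤ ε ^ (-p) :=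
      Real.rpow_le_rpow_of_nonpos e0 (le_max_left _ _) (by linarith)
    calc _ ≤ 1 * ε ^ (-p) := by
          apply mul_le_mul a1 a2 (by positivity) (by norm_num)
      _ = _ := one_mul _
  have i2 : IntegrableOn (Kbar d p τ) (Set.Ioi 1) := by
    apply (integrableOn_Ioi_rpow_of_lt (a := -(p - d + 1)) (by linarith) one_pos).congr_fun
      _ measurableSet_Ioi
    intro ρ hρ
    exact (ht ρ (le_of_lt hρ)).symm
  have i3 : IntegrableOn (Kbar d p τ) (Set.Ioi 0) := by
    rw [← Set.Ioc_union_Ioi_eq_Ioi (zero_le_one (α := ℝ))]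
    exact i1.union i2
  have i4 : IntegrableOn (Kbar d p τ) (Set.Iic 0) := by
    rw [integrableOn_Iic_iff_integrableOn_Iio]
    have := (Measure.measurePreserving_neg (volume : Measure ℝ)).integrableOn_comp_preimage
      (measurableEmbedding_neg) (f := Kbar d p τ) (s := Set.Ioi 0)
    rw [Set.neg_preimage, Set.neg_Ioi, neg_zero] at this
    have h2 := this.2 i3
    refine h2.congr_fun (fun ρ _ => ?_) measurableSet_Iio
    exact hev ρ
  refine ⟨hev, hnn, hm, ?_, ht, by linarith⟩
  rw [← integrableOn_univ, ← Set.Iic_union_Ioi (a := (0:ℝ))]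
  exact i4.union i3

lemma ind_val (E : Set ℝ) (u : ℝ) : ind E u = 0 ∨ ind E u = 1 := by
  unfold ind
  by_cases h : u ∈ E <;> simp [h]

lemma ind_bd (E : Set ℝ) (u v : ℝ) : |ind E u - ind E v| ≤ 1 := by
  rcases ind_val E u with h | h <;> rcases ind_val E v with h' | h' <;> simp [h, h']

lemma ind_meas {E : Set ℝ} (h : MeasurableSet E) : Measurable (ind E) :=
  measurable_const.indicator h

lemma ex_of_ae {Q : ℝ → Prop} (h : ∀ᵐ u ∂(volume : Measure ℝ), Q u) {a b : ℝ} (hab : a < b) :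
    ∃ u ∈ Set.Ioo a b, Q u := by
  by_contra hc
  push Not at hc
  have : Set.Ioo a b ⊆ {u | ¬ Q u} := fun u hu => hc u hu
  have h2 := measure_mono_null this h
  simp at h2
  linarith

lemma aeconst_conn {E B : Set ℝ} (h : IsOneDPerimeterSet E B) {A : Set ℝ} (hA : IsOpen A)
    (hA2 : A.OrdConnected) (hAB : ∀ u ∈ A, u ∉ B) :
    ∃ c, ∀ᵐ u ∂(volume : Measure ℝ), u ∈ A → ind E u = c := by
  obtain ⟨_, _, _, h4, _⟩ := h
  have key : ∀ a b : ℚ, ∃ c : ℝ, (Set.Ioo (a:ℝ) b ∩ B = ∅) → ∀ᵐ u ∂(volume : Measure ℝ),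
      u ∈ Set.Ioo (a:ℝ) b → ind E u = c := by
    intro a b
    by_cases hf : Set.Ioo (a:ℝ) b ∩ B = ∅
    · by_cases hab : (a:ℝ) < b
      · obtain ⟨c, hc⟩ := h4 a b hab hf
        exact ⟨c, fun _ => (ae_restrict_iff' measurableSet_Ioo).1 hc⟩
      · refine ⟨0, fun _ => Eventually.of_forall fun u hu => ?_⟩
        exact absurd (hu.1.trans hu.2) hab
    · exact ⟨0, fun h => absurd h hf⟩
  choose c hc using key
  have hG : ∀ᵐ u ∂(volume : Measure ℝ), ∀ a b : ℚ, (Set.Ioo (a:ℝ) b ∩ B = ∅) →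
      u ∈ Set.Ioo (a:ℝ) b → ind E u = c a b := by
    rw [ae_all_iff]; intro a
    rw [ae_all_iff]; intro b
    by_cases hf : Set.Ioo (a:ℝ) b ∩ B = ∅
    · filter_upwards [hc a b hf] with u hu _ using hu
    · exact Eventually.of_forall fun u h => absurd h hf
  have two : ∀ u v, u ≤ v → u ∈ A → v ∈ A → (∀ a b : ℚ, (Set.Ioo (a:ℝ) b ∩ B = ∅) →
      u ∈ Set.Ioo (a:ℝ) b → ind E u = c a b) → (∀ a b : ℚ, (Set.Ioo (a:ℝ) b ∩ B = ∅) →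
      v ∈ Set.Ioo (a:ℝ) b → ind E v = c a b) → ind E u = ind E v := by
    intro u v huv hu hv gu gv
    obtain ⟨e1, e1p, he1⟩ := Metric.isOpen_iff.1 hA u hu
    obtain ⟨e2, e2p, he2⟩ := Metric.isOpen_iff.1 hA v hv
    obtain ⟨a, ha1, ha2⟩ := exists_rat_btwn (show u - e1 < u by linarith)
    obtain ⟨b, hb1, hb2⟩ := exists_rat_btwn (show v < v + e2 by linarith)
    have haA : (a:ℝ) ∈ A := he1 (by rw [Metric.mem_ball, Real.dist_eq, abs_lt]; constructor <;> linarith)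
    have hbA : (b:ℝ) ∈ A := he2 (by rw [Metric.mem_ball, Real.dist_eq, abs_lt]; constructor <;> linarith)
    have hf : Set.Ioo (a:ℝ) b ∩ B = ∅ := by
      rw [Set.eq_empty_iff_forall_notMem]
      rintro t ⟨ht, htB⟩
      exact hAB t (hA2.out haA hbA ⟨ht.1.le, ht.2.le⟩) htB
    rw [gu a b hf ⟨ha2, by linarith⟩, gv a b hf ⟨by linarith, hb1⟩]
  by_cases hex : ∃ u0 ∈ A, ∀ a b : ℚ, (Set.Ioo (a:ℝ) b ∩ B = ∅) →
      u0 ∈ Set.Ioo (a:ℝ) b → ind E u0 = c a b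
  · obtain ⟨u0, hu0, g0⟩ := hex
    refine ⟨ind E u0, ?_⟩
    filter_upwards [hG] with u gu hu
    rcases le_total u u0 with hle | hle
    · exact two u u0 hle hu hu0 gu g0
    · exact (two u0 u hle hu0 hu g0 gu).symm
  · refine ⟨0, ?_⟩
    filter_upwards [hG] with u gu hu
    exact absurd ⟨u, hu, gu⟩ hex

lemma aeconst_Ioo {E B : Set ℝ} (h : IsOneDPerimeterSet E B) (a b : ℝ)
    (hAB : ∀ u ∈ Set.Ioo a b, u ∉ B) :
    ∃ c, ∀ᵐ u ∂(volume : Measure ℝ), u ∈ Set.Ioo a b → ind E u = c :=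
  aeconst_conn h isOpen_Ioo Set.ordConnected_Ioo hAB

lemma jump {E B : Set ℝ} (h : IsOneDPerimeterSet E B) {a s b c1 c2 : ℝ} (has : a < s) (hsb : s < b)
    (hs : s ∈ B) (f1 : ∀ u ∈ Set.Ioo a s, u ∉ B) (f2 : ∀ u ∈ Set.Ioo s b, u ∉ B)
    (h1 : ∀ᵐ u ∂(volume : Measure ℝ), u ∈ Set.Ioo a s → ind E u = c1)
    (h2 : ∀ᵐ u ∂(volume : Measure ℝ), u ∈ Set.Ioo s b → ind E u = c2) :
    (c1 = 0 ∧ c2 = 1) ∨ (c1 = 1 ∧ c2 = 0) := by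
  have hne := h.2.2.2.2 s hs a b has hsb
    (Set.eq_empty_iff_forall_notMem.2 fun u hu => f1 u hu.1 hu.2)
    (Set.eq_empty_iff_forall_notMem.2 fun u hu => f2 u hu.1 hu.2) c1 c2
    ((ae_restrict_iff' measurableSet_Ioo).2 h1) ((ae_restrict_iff' measurableSet_Ioo).2 h2)
  obtain ⟨u, hu, e1⟩ := ex_of_ae h1 has
  obtain ⟨v, hv, e2⟩ := ex_of_ae h2 hsb
  have e1 := e1 hu
  have e2 := e2 hv
  rcases ind_val E u with h | h <;> rcases ind_val E v with h' | h' <;>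
    rw [h] at e1 <;> rw [h'] at e2 <;> subst e1 <;> subst e2 <;> simp at hne ⊢

/-- the jump set inherits periodicity -/
lemma B_shift {E B : Set ℝ} (h : IsOneDPerimeterSet E B) (L : ℝ) (hper : ∀ x, x ∈ E ↔ x + L ∈ E)
    (t : ℝ) (ht : t ∈ B) : t + L ∈ B := by
  by_contra hc
  have ho : IsOpen Bᶜ := h.2.1.isOpen_compl
  obtain ⟨e, ep, he⟩ := Metric.isOpen_iff.1 ho (t + L) hc
  have hfin : (B ∩ Set.Icc (t-1) (t+1)).Finite := h.2.2.1 _ isCompact_Icc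
  have hcl : IsClosed ((B ∩ Set.Icc (t-1) (t+1)) \ {t}) := (hfin.subset Set.sdiff_subset).isClosed
  obtain ⟨e', ep', he'⟩ := Metric.isOpen_iff.1 hcl.isOpen_compl t (by simp)
  set δ := min 1 (min e e') with hδ
  have δ0 : 0 < δ := by positivity
  have d1 : δ ≤ 1 := min_le_left _ _
  have d2 : δ ≤ e := (min_le_right _ _).trans (min_le_left _ _)
  have d3 : δ ≤ e' := (min_le_right _ _).trans (min_le_right _ _)
  have free : ∀ u, t - δ < u → u < t + δ → u ≠ t → u ∉ B := by
    intro u h1 h2 h3 h4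
    have : u ∈ Metric.ball t e' := by
      rw [Metric.mem_ball, Real.dist_eq, abs_lt]; constructor <;> linarith
    exact he' this ⟨⟨h4, by constructor <;> linarith⟩, h3⟩
  obtain ⟨c, hc⟩ := aeconst_Ioo h (t + L - δ) (t + L + δ) (by
    intro u hu
    apply he
    rw [Metric.mem_ball, Real.dist_eq, abs_lt]; constructor <;> linarith [hu.1, hu.2])
  have hc2 := (measurePreserving_add_right volume L).quasiMeasurePreserving.ae hc
  have hi : ∀ u, ind E (u + L) = ind E u := by
    intro u
    unfold ind
    by_cases hu : u ∈ E
    · rw [Set.indicator_of_mem hu, Set.indicator_of_mem ((hper u).1 hu)]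
    · rw [Set.indicator_of_notMem hu, Set.indicator_of_notMem (fun hh => hu ((hper u).2 hh))]
  have := jump h (a := t - δ) (b := t + δ) (c1 := c) (c2 := c) (by linarith) (by linarith) ht
    (fun u hu => free u hu.1 (by linarith [hu.2]) (by linarith [hu.2] |> fun (h : u < t) => h.ne))
    (fun u hu => free u (by linarith [hu.1]) hu.2 (by linarith [hu.1] |> fun (h : t < u) => h.ne'))
    (by filter_upwards [hc2] with u hu hm
        rw [← hi u]; exact hu ⟨by linarith [hm.1], by linarith [hm.2]⟩)
    (by filter_upwards [hc2] with u hu hm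
        rw [← hi u]; exact hu ⟨by linarith [hm.1], by linarith [hm.2]⟩)
  rcases this with ⟨a, b⟩ | ⟨a, b⟩ <;> rw [a] at b <;> norm_num at b

lemma ind_per {E : Set ℝ} {L : ℝ} (hper : ∀ x, x ∈ E ↔ x + L ∈ E) (u : ℝ) :
    ind E (u + L) = ind E u := by
  unfold ind
  by_cases hu : u ∈ E
  · rw [Set.indicator_of_mem hu, Set.indicator_of_mem ((hper u).1 hu)]
  · rw [Set.indicator_of_notMem hu, Set.indicator_of_notMem (fun hh => hu ((hper u).2 hh))]

lemma succPt_eq {B : Set ℝ} {s t : ℝ} (ht : t ∈ B) (hst : s < t) (hf : ∀ u ∈ Set.Ioo s t, u ∉ B) :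
    succPt B s = (t : EReal) := by
  unfold succPt
  apply le_antisymm
  · exact sInf_le ⟨t, ⟨ht, hst⟩, rfl⟩
  · apply le_sInf
    rintro _ ⟨u, ⟨hu, hsu⟩, rfl⟩
    have : t ≤ u := by
      by_contra hc
      exact hf u ⟨hsu, not_le.1 hc⟩ hu
    exact EReal.coe_le_coe_iff.2 this

lemma predPt_eq {B : Set ℝ} {s t : ℝ} (ht : t ∈ B) (hst : t < s) (hf : ∀ u ∈ Set.Ioo t s, u ∉ B) :
    predPt B s = (t : EReal) := by
  unfold predPt
  apply le_antisymm
  · apply sSup_le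
    rintro _ ⟨u, ⟨hu, hsu⟩, rfl⟩
    have : u ≤ t := by
      by_contra hc
      exact hf u ⟨not_le.1 hc, hsu⟩ hu
    exact EReal.coe_le_coe_iff.2 this
  · exact le_sSup ⟨t, ⟨ht, hst⟩, rfl⟩

def LA (B : Set ℝ) (s : ℝ) : Set ℝ := {u : ℝ | predPt B s < (u : EReal) ∧ u < s}
def RA (B : Set ℝ) (s : ℝ) : Set ℝ := {u : ℝ | s < u ∧ (u : EReal) < succPt B s}

lemma LA_eq {B : Set ℝ} {s t : ℝ} (h : predPt B s = (t : EReal)) : LA B s = Set.Ioo t s := by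
  ext u
  show (predPt B s < (u : EReal) ∧ u < s) ↔ (t < u ∧ u < s)
  rw [h, EReal.coe_lt_coe_iff]

lemma RA_eq {B : Set ℝ} {s t : ℝ} (h : succPt B s = (t : EReal)) : RA B s = Set.Ioo s t := by
  ext u
  show (s < u ∧ (u : EReal) < succPt B s) ↔ (s < u ∧ u < t)
  rw [h, EReal.coe_lt_coe_iff]

lemma LA_open (B : Set ℝ) (s : ℝ) : IsOpen (LA B s) :=
  (isOpen_lt continuous_const continuous_coe_real_ereal).inter (isOpen_lt continuous_id continuous_const)

lemma RA_open (B : Set ℝ) (s : ℝ) : IsOpen (RA B s) :=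
  (isOpen_lt continuous_const continuous_id).inter (isOpen_lt continuous_coe_real_ereal continuous_const)

lemma LA_conn (B : Set ℝ) (s : ℝ) : (LA B s).OrdConnected := by
  refine ⟨fun x hx y hy z hz => ⟨lt_of_lt_of_le hx.1 (by exact_mod_cast hz.1), lt_of_le_of_lt hz.2 hy.2⟩⟩

lemma RA_conn (B : Set ℝ) (s : ℝ) : (RA B s).OrdConnected := by
  refine ⟨fun x hx y hy z hz => ⟨lt_of_lt_of_le hx.1 hz.1, lt_of_le_of_lt (by exact_mod_cast hz.2) hy.2⟩⟩

lemma LA_free (B : Set ℝ) (s : ℝ) : ∀ u ∈ LA B s, u ∉ B := by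
  intro u hu hB
  exact absurd (le_sSup ⟨u, ⟨hB, hu.2⟩, rfl⟩ : (u : EReal) ≤ predPt B s) (not_le.2 hu.1)

lemma RA_free (B : Set ℝ) (s : ℝ) : ∀ u ∈ RA B s, u ∉ B := by
  intro u hu hB
  exact absurd (sInf_le ⟨u, ⟨hB, hu.1⟩, rfl⟩ : succPt B s ≤ (u : EReal)) (not_le.2 hu.2)

lemma LA_sub {B : Set ℝ} {s : ℝ} (h : ∀ t ∈ B, t < s → t ≤ s - 1) : Set.Ioo (s-1) s ⊆ LA B s := by
  intro u hu
  refine ⟨lt_of_le_of_lt (b := ((s - 1 : ℝ) : EReal)) ?_ (by exact_mod_cast hu.1), hu.2⟩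
  apply sSup_le
  rintro _ ⟨t, ⟨ht, hts⟩, rfl⟩
  exact EReal.coe_le_coe_iff.2 (h t ht hts)

lemma RA_sub {B : Set ℝ} {s : ℝ} (h : ∀ t ∈ B, s < t → s + 1 ≤ t) : Set.Ioo s (s+1) ⊆ RA B s := by
  intro u hu
  refine ⟨hu.1, lt_of_lt_of_le (b := ((s + 1 : ℝ) : EReal)) (by exact_mod_cast hu.2) ?_⟩
  apply le_sInf
  rintro _ ⟨t, ⟨ht, hts⟩, rfl⟩
  exact EReal.coe_le_coe_iff.2 (h t ht hts)

def cst (d : ℕ) (p τ : ℝ) : ℝ := ∫ ρ in Set.Ioo (-1 : ℝ) 1, |ρ| * Kbar d p τ ρ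

lemma rPt_eq (d : ℕ) (p τ : ℝ) (E B : Set ℝ) (s : ℝ) : rPt d p τ E B s =
    cst d p τ - (∫ u in LA B s, Pf (Kbar d p τ) (ind E) u) -
      ∫ u in RA B s, Nf (Kbar d p τ) (ind E) u := rfl

lemma Ioo_int {h : ℝ → ℝ} {a b : ℝ} (hab : a ≤ b) : ∫ u in Set.Ioo a b, h u = ∫ u in a..b, h u := by
  rw [intervalIntegral.integral_of_le hab, integral_Ioc_eq_integral_Ioo]

lemma sumr (d : ℕ) (p τ q : ℝ) (hK : KG (Kbar d p τ) q) (E B : Set ℝ) (hE : MeasurableSet E)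
    (M : ℕ) (z : ℕ → ℝ) (hz : ∀ i < M, z i < z (i+1))
    (hs : ∀ i < M, succPt B (z i) = (z (i+1) : ℝ)) (hp : ∀ i < M, predPt B (z (i+1)) = (z i : ℝ)) :
    ∑ i ∈ Finset.range (M+1), rPt d p τ E B (z i) = (M+1) * cst d p τ
      - ((∫ u in LA B (z 0), Pf (Kbar d p τ) (ind E) u) +
          ∫ u in (z 0)..(z M), Pf (Kbar d p τ) (ind E) u)
      - ((∫ u in RA B (z M), Nf (Kbar d p τ) (ind E) u) +
          ∫ u in (z 0)..(z M), Nf (Kbar d p τ) (ind E) u) := by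
  simp_rw [rPt_eq]
  rw [Finset.sum_sub_distrib, Finset.sum_sub_distrib]
  have iP := Pf_ii hK (ind_meas hE) 1 (ind_bd E)
  have iN := Nf_ii hK (ind_meas hE) 1 (ind_bd E)
  rw [Finset.sum_range_succ' (fun i => ∫ u in LA B (z i), Pf (Kbar d p τ) (ind E) u),
    Finset.sum_range_succ (fun i => ∫ u in RA B (z i), Nf (Kbar d p τ) (ind E) u),
    ← intervalIntegral.sum_integral_adjacent_intervals (fun k _ => iP (z k) (z (k+1))),
    ← intervalIntegral.sum_integral_adjacent_intervals (fun k _ => iN (z k) (z (k+1)))]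
  have a1 : ∑ i ∈ Finset.range M, ∫ u in LA B (z (i+1)), Pf (Kbar d p τ) (ind E) u =
      ∑ i ∈ Finset.range M, ∫ u in (z i)..(z (i+1)), Pf (Kbar d p τ) (ind E) u := by
    apply Finset.sum_congr rfl
    intro i hi
    have hi := Finset.mem_range.1 hi
    rw [LA_eq (hp i hi), Ioo_int (hz i hi).le]
  have a2 : ∑ i ∈ Finset.range M, ∫ u in RA B (z i), Nf (Kbar d p τ) (ind E) u =
      ∑ i ∈ Finset.range M, ∫ u in (z i)..(z (i+1)), Nf (Kbar d p τ) (ind E) u := by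
    apply Finset.sum_congr rfl
    intro i hi
    have hi := Finset.mem_range.1 hi
    rw [RA_eq (hs i hi), Ioo_int (hz i hi).le]
  rw [a1, a2]
  simp
  ring

lemma r_nonpos (d : ℕ) (p τ q : ℝ) (hK : KG (Kbar d p τ) q) {E B : Set ℝ}
    (h : IsOneDPerimeterSet E B) {a s b : ℝ} (hs : s ∈ B) (hpr : predPt B s = (a : ℝ))
    (hsu : succPt B s = (b : ℝ)) (ha : a ≤ s - 1) (hb : s + 1 ≤ b) : rPt d p τ E B s ≤ 0 := by
  have hm := ind_meas h.1
  have eL := LA_eq hpr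
  have eR := RA_eq hsu
  have f1 : ∀ u ∈ Set.Ioo a s, u ∉ B := fun u hu => LA_free B s u (eL ▸ hu)
  have f2 : ∀ u ∈ Set.Ioo s b, u ∉ B := fun u hu => RA_free B s u (eR ▸ hu)
  obtain ⟨c1, h1⟩ := aeconst_Ioo h a s f1
  obtain ⟨c2, h2⟩ := aeconst_Ioo h s b f2
  have hj := jump h (by linarith) (by linarith) hs f1 f2 h1 h2
  have hj1 : |c2 - c1| = 1 := by rcases hj with ⟨rfl, rfl⟩ | ⟨rfl, rfl⟩ <;> norm_num
  have hj2 : |c1 - c2| = 1 := by rw [abs_sub_comm]; exact hj1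
  have G1 := left_ge hK hm (ind_bd E) s a c1 c2 ha
    (by filter_upwards [h1] with u hu hm using hu ⟨by linarith [hm.1], hm.2⟩)
    (by filter_upwards [h2] with u hu hm using hu ⟨hm.1, by linarith [hm.2]⟩) hj1
  have qm := (Measure.measurePreserving_neg (volume : Measure ℝ)).quasiMeasurePreserving
  have G2 := left_ge hK (f := fun v => ind E (-v)) (hm.comp measurable_neg)
    (fun u v => ind_bd E _ _) (-s) (-b) c2 c1 (by linarith)
    (by filter_upwards [qm.ae h2] with u hu hm using hu ⟨by linarith [hm.2], by linarith [hm.1]⟩)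
    (by filter_upwards [qm.ae h1] with u hu hm using hu ⟨by linarith [hm.2], by linarith [hm.1]⟩) hj2
  have e3 : Neg.neg ⁻¹' (Set.Ioo s b) = Set.Ioo (-b) (-s) := by
    rw [Set.neg_preimage, Set.neg_Ioo]
  rw [rPt_eq, eL, eR, Nf_set hK, e3]
  unfold cst
  rw [cst_eq hK]
  linarith

lemma fsum_eq (x : ℕ → ℝ) (n : ℕ) (hinj : ∀ i j, i < j → j < n → x i < x j) (S : Set ℝ)
    (hS : ∀ t, t ∈ S ↔ ∃ i < n, t = x i) (g : ℝ → ℝ) :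
    ∑ᶠ s ∈ S, g s = ∑ i ∈ Finset.range n, g (x i) ∧ S.ncard = n := by
  have hi : Set.InjOn x (Finset.range n : Finset ℕ) := by
    intro i hi j hj hij
    have hi : i < n := by simpa using hi
    have hj : j < n := by simpa using hj
    rcases lt_trichotomy i j with h | h | h
    · exact absurd hij (hinj i j h hj).ne
    · exact h
    · exact absurd hij (hinj j i h hi).ne'
  have e : S = ((Finset.range n).image x : Finset ℝ) := by
    ext t
    rw [hS]
    simp only [Finset.coe_image, Set.mem_image, Finset.coe_range, Set.mem_Iio]
    constructor
    · rintro ⟨i, h, rfl⟩; exact ⟨i, h, rfl⟩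
    · rintro ⟨i, h, rfl⟩; exact ⟨i, h, rfl⟩
  rw [e, finsum_mem_coe_finset, Set.ncard_coe_finset, Finset.sum_image hi, Finset.card_image_of_injOn hi]
  simp

lemma Nf_ivl {K : ℝ → ℝ} {q : ℝ} (hK : KG K q) (f : ℝ → ℝ) (a b : ℝ) :
    ∫ u in a..b, Nf K f u = ∫ u in (-b)..(-a), Pf K (fun v => f (-v)) u := by
  rw [← intervalIntegral.integral_comp_neg]
  congr 1; ext u; exact Nf_eq hK f u

lemma Pf_per {K : ℝ → ℝ} {f : ℝ → ℝ} {L : ℝ} (hper : ∀ u, f (u + L) = f u) (u : ℝ) :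
    Pf K f (u + L) = Pf K f u := by
  unfold Pf
  congr 1; ext ρ
  rw [hper, show u + L + ρ = (u + ρ) + L by ring, hper]

lemma period_sum (d : ℕ) (p τ q : ℝ) (hK : KG (Kbar d p τ) q) (E B : Set ℝ) (hE : MeasurableSet E)
    (L : ℝ) (hL : 0 < L) (hper : ∀ u, ind E (u + L) = ind E u)
    (M : ℕ) (x : ℕ → ℝ) (hz : ∀ i < M, x i < x (i+1)) (hM : x M < x 0 + L)
    (hs : ∀ i < M, succPt B (x i) = (x (i+1) : ℝ)) (hp : ∀ i < M, predPt B (x (i+1)) = (x i : ℝ))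
    (hp0 : predPt B (x 0) = (x M - L : ℝ)) (hsM : succPt B (x M) = (x 0 + L : ℝ)) :
    ∑ i ∈ Finset.range (M+1), rPt d p τ E B (x i) = (M+1) * cst d p τ
      - ∫ ρ in Set.Ioi (0:ℝ), Vf (fun u => 2 * ind E u - 1) (x 0) L ρ * Kbar d p τ ρ := by
  have iP := Pf_ii hK (ind_meas hE) 1 (ind_bd E)
  have iN := Nf_ii hK (ind_meas hE) 1 (ind_bd E)
  rw [sumr d p τ q hK E B hE M x hz hs hp, LA_eq hp0, RA_eq hsM, Ioo_int hM.le,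
    Ioo_int (by linarith)]
  have e1 : ∫ u in (x M - L)..(x 0), Pf (Kbar d p τ) (ind E) u =
      ∫ u in (x M)..(x 0 + L), Pf (Kbar d p τ) (ind E) u := by
    have := intervalIntegral.integral_comp_add_right (a := x M - L) (b := x 0)
      (fun u => Pf (Kbar d p τ) (ind E) u) L
    rw [sub_add_cancel] at this
    rw [← this]
    congr 1; ext u; exact (Pf_per hper u).symm
  have e2 := intervalIntegral.integral_add_adjacent_intervals (iP (x 0) (x M)) (iP (x M) (x 0 + L))
  have e3 := intervalIntegral.integral_add_adjacent_intervals (iN (x 0) (x M)) (iN (x M) (x 0 + L))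
  have e4 := PN_total hK (ind_meas hE) 1 (ind_bd E) (x 0) L hL hper
  have e5 : ∀ ρ, Vf (fun u => 2 * ind E u - 1) (x 0) L ρ = 2 * Vf (ind E) (x 0) L ρ := by
    intro ρ
    unfold Vf
    rw [← intervalIntegral.integral_const_mul]
    congr 1; ext u
    rw [show 2 * ind E (u + ρ) - 1 - (2 * ind E u - 1) = 2 * (ind E (u+ρ) - ind E u) by ring, abs_mul]
    norm_num
  simp_rw [e5, mul_assoc]
  rw [integral_const_mul, ← e4, e1, ← e2, ← e3]
  ring

lemma ind_inter {F Ft I : Set ℝ} (h : Ft ∩ I = F ∩ I) (u : ℝ) (hu : u ∈ I) : ind F u = ind Ft u := by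
  have : u ∈ Ft ↔ u ∈ F := by
    constructor
    · intro hh; exact (h ▸ (⟨hh, hu⟩ : u ∈ Ft ∩ I) : u ∈ F ∩ I).1
    · intro hh; exact (h.symm ▸ (⟨hh, hu⟩ : u ∈ F ∩ I) : u ∈ Ft ∩ I).1
  unfold ind
  by_cases hF : u ∈ F
  · rw [Set.indicator_of_mem hF, Set.indicator_of_mem (this.2 hF)]
  · rw [Set.indicator_of_notMem hF, Set.indicator_of_notMem (fun hh => hF (this.1 hh))]

lemma part1_core (d : ℕ) (p τ q : ℝ) (hK : KG (Kbar d p τ) q) {F BF Ft BFt : Set ℝ}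
    (hF : IsOneDPerimeterSet F BF) (hFt : IsOneDPerimeterSet Ft BFt) (a b : ℝ)
    (hI : Ft ∩ Set.Ioo a b = F ∩ Set.Ioo a b)
    (M : ℕ) (z : ℕ → ℝ) (hz : ∀ i < M, z i < z (i+1)) (hz0M : z 0 ≤ z M)
    (haz : a < z 0) (hzb : z M < b)
    (hs : ∀ i < M, succPt BF (z i) = (z (i+1) : ℝ)) (hp : ∀ i < M, predPt BF (z (i+1)) = (z i : ℝ))
    (hs' : ∀ i < M, succPt BFt (z i) = (z (i+1) : ℝ))
    (hp' : ∀ i < M, predPt BFt (z (i+1)) = (z i : ℝ))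
    (hl : ∀ t ∈ BF, t < z 0 → t ≤ z 0 - 1) (hr : ∀ t ∈ BF, z M < t → z M + 1 ≤ t)
    (y w : ℝ) (hy : y ≤ z 0 - 1) (hw : z M + 1 ≤ w)
    (hp0 : predPt BFt (z 0) = (y : ℝ)) (hsM : succPt BFt (z M) = (w : ℝ)) :
    ∑ i ∈ Finset.range (M+1), rPt d p τ Ft BFt (z i) - 4 * (1 / ((q-1)*(q-2))) ≤
      ∑ i ∈ Finset.range (M+1), rPt d p τ F BF (z i) := by
  have mF := ind_meas hF.1
  have mFt := ind_meas hFt.1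
  have eL := LA_eq hp0
  have eR := RA_eq hsM
  have sL := LA_sub hl
  have sR := RA_sub hr
  obtain ⟨c1, h1⟩ := aeconst_conn hF (LA_open BF (z 0)) (LA_conn _ _) (LA_free _ _)
  obtain ⟨c2, h2⟩ := aeconst_conn hF (RA_open BF (z M)) (RA_conn _ _) (RA_free _ _)
  obtain ⟨c1', h1'⟩ := aeconst_conn hFt (LA_open BFt (z 0)) (LA_conn _ _) (LA_free _ _)
  obtain ⟨c2', h2'⟩ := aeconst_conn hFt (RA_open BFt (z M)) (RA_conn _ _) (RA_free _ _)
  have sL' : Set.Ioo (z 0 - 1) (z 0) ⊆ LA BFt (z 0) := by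
    rw [eL]; exact Set.Ioo_subset_Ioo_left hy
  have sR' : Set.Ioo (z M) (z M + 1) ⊆ RA BFt (z M) := by
    rw [eR]; exact Set.Ioo_subset_Ioo_right hw
  have E1 : c1 = c1' := by
    obtain ⟨u, hu, g1, g2⟩ := ex_of_ae (h1.and h1') (show max a (z 0 - 1) < z 0 from
      max_lt haz (by linarith))
    have ha := lt_of_le_of_lt (le_max_left _ _) hu.1
    have hb := lt_of_le_of_lt (le_max_right _ _) hu.1
    rw [← g1 (sL ⟨hb, hu.2⟩), ← g2 (sL' ⟨hb, hu.2⟩)]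
    exact ind_inter hI u ⟨ha, by linarith [hu.2]⟩
  have E2 : c2 = c2' := by
    obtain ⟨u, hu, g1, g2⟩ := ex_of_ae (h2.and h2') (show z M < min b (z M + 1) from
      lt_min hzb (by linarith))
    have ha := lt_of_lt_of_le hu.2 (min_le_left _ _)
    have hb := lt_of_lt_of_le hu.2 (min_le_right _ _)
    rw [← g1 (sR ⟨hu.1, hb⟩), ← g2 (sR' ⟨hu.1, hb⟩)]
    exact ind_inter hI u ⟨by linarith [hu.1], ha⟩
  have hfg : ∀ᵐ u ∂volume, u ∈ Set.Ioo (z 0 - 1) (z M + 1) → ind F u = ind Ft u := by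
    filter_upwards [h1, h1', h2, h2'] with u g1 g1' g2 g2' hu
    by_cases hc1 : u < z 0
    · rw [g1 (sL ⟨hu.1, hc1⟩), g1' (sL' ⟨hu.1, hc1⟩), E1]
    by_cases hc2 : z M < u
    · rw [g2 (sR ⟨hc2, hu.2⟩), g2' (sR' ⟨hc2, hu.2⟩), E2]
    exact ind_inter hI u ⟨by linarith, by linarith⟩
  have qm := (Measure.measurePreserving_neg (volume : Measure ℝ)).quasiMeasurePreserving
  have G1 := left_lemma hK mF mFt (ind_bd F) (ind_bd Ft) (z 0) (z M) hz0M (LA BF (z 0))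
    (LA_open _ _).measurableSet sL (fun u hu => hu.2)
    (by
      filter_upwards [h1] with u gu hu
      filter_upwards [h1] with v gv hv
      rw [gu hu, gv ⟨lt_trans hu.1 (by exact_mod_cast hv.1), hv.2⟩])
    hfg y hy
  have G2 := left_lemma hK (f := fun v => ind F (-v)) (g := fun v => ind Ft (-v))
    (mF.comp measurable_neg) (mFt.comp measurable_neg) (fun u v => ind_bd F _ _)
    (fun u v => ind_bd Ft _ _) (-z M) (-z 0) (by linarith) (Neg.neg ⁻¹' RA BF (z M))
    ((RA_open _ _).measurableSet.preimage measurable_neg)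
    (fun u hu => sR ⟨by linarith [hu.2], by linarith [hu.1]⟩)
    (fun u hu => by
      have : z M < -u := hu.1
      show u < - z M
      linarith)
    (by
      filter_upwards [qm.ae h2] with u gu hu
      filter_upwards [qm.ae h2] with v gv hv
      rw [gu hu, gv ⟨by linarith [hv.2], lt_trans (EReal.coe_lt_coe_iff.2 (by linarith [hv.1])) hu.2⟩])
    (by
      filter_upwards [qm.ae hfg] with u hu hm
      exact hu ⟨by linarith [hm.2], by linarith [hm.1]⟩)
    (-w) (by linarith)
  rw [sumr d p τ q hK F BF hF.1 M z hz hs hp, sumr d p τ q hK Ft BFt hFt.1 M z hz hs' hp',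
    eL, eR, Nf_set hK, Nf_set hK, Nf_ivl hK, Nf_ivl hK]
  have e3 : Neg.neg ⁻¹' (Set.Ioo (z M) w) = Set.Ioo (-w) (-z M) := by
    rw [Set.neg_preimage, Set.neg_Ioo]
  rw [e3]
  linarith

structure Per (E B : Set ℝ) (N : ℕ) (k : ℕ → ℝ) (L : ℝ) : Prop where
  h : IsOneDPerimeterSet E B
  per : ∀ x, x ∈ E ↔ x + L ∈ E
  hN : 2 ≤ N
  even : Even N
  mono : ∀ i j, i < j → j ≤ N → k i < k j
  gap : ∀ i < N, 1 < k (i+1) - k i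
  kN : k N = k 0 + L
  mem : ∀ i ≤ N, k i ∈ B
  ex : ∀ t ∈ B, k 0 ≤ t → t ≤ k N → ∃ i ≤ N, t = k i

namespace Per
variable {E B : Set ℝ} {N : ℕ} {k : ℕ → ℝ} {L : ℝ}

lemma mono' (H : Per E B N k L) (i j : ℕ) (hij : i ≤ j) (hj : j ≤ N) : k i ≤ k j := by
  rcases hij.lt_or_eq with h | h
  · exact (H.mono i j h hj).le
  · rw [h]

lemma Lpos (H : Per E B N k L) : 0 < L := by
  have := H.mono 0 N (by have := H.hN; omega) le_rfl
  have := H.kN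
  linarith

lemma free (H : Per E B N k L) (i : ℕ) (hi : i < N) : ∀ u ∈ Set.Ioo (k i) (k (i+1)), u ∉ B := by
  intro u hu hB
  obtain ⟨j, hj, rfl⟩ := H.ex u hB ((H.mono' 0 i (by omega) (by omega)).trans hu.1.le)
    (hu.2.le.trans (H.mono' (i+1) N (by omega) le_rfl))
  rcases le_or_gt j i with h | h
  · exact absurd (H.mono' j i h (by omega)) (not_le.2 hu.1)
  · exact absurd (H.mono' (i+1) j h hj) (not_le.2 hu.2)

lemma succ (H : Per E B N k L) (i : ℕ) (hi : i < N) : succPt B (k i) = (k (i+1) : ℝ) :=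
  succPt_eq (H.mem _ (by omega)) (H.mono _ _ (by omega) (by omega)) (H.free i hi)

lemma pred (H : Per E B N k L) (i : ℕ) (hi : i < N) : predPt B (k (i+1)) = (k i : ℝ) :=
  predPt_eq (H.mem _ (by omega)) (H.mono _ _ (by omega) (by omega)) (H.free i hi)

lemma pred0 (H : Per E B N k L) : predPt B (k 0) = (k (N-1) - L : ℝ) := by
  have hN := H.hN
  have kN := H.kN
  have hn : N - 1 + 1 = N := by omega
  apply predPt_eq
  · rw [sub_eq_add_neg]
    apply B_shift H.h
    · intro x
      have := H.per (x + -L)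
      rw [neg_add_cancel_right] at this
      exact this.symm
    · exact H.mem _ (by omega)
  · have := H.mono (N-1) N (by omega) le_rfl
    linarith
  · intro u hu hB
    have h1 := B_shift H.h L H.per u hB
    refine H.free (N-1) (by omega) (u + L) ⟨by linarith [hu.1], ?_⟩ h1
    rw [hn]; linarith [hu.2]

lemma fs (H : Per E B N k L) (g : ℝ → ℝ) :
    ∑ᶠ s ∈ B ∩ Set.Ico (k 0) (k N), g s = ∑ i ∈ Finset.range N, g (k i) ∧
      (B ∩ Set.Ico (k 0) (k N)).ncard = N := by
  apply fsum_eq k N (fun i j hij hj => H.mono i j hij hj.le)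
  intro t
  constructor
  · rintro ⟨hB, h1, h2⟩
    obtain ⟨i, hi, rfl⟩ := H.ex t hB h1 h2.le
    refine ⟨i, lt_of_le_of_ne hi ?_, rfl⟩
    rintro rfl
    exact lt_irrefl _ h2
  · rintro ⟨i, hi, rfl⟩
    exact ⟨H.mem i hi.le, H.mono' 0 i (by omega) hi.le, H.mono i N hi le_rfl⟩

lemma nonpos (H : Per E B N k L) (d : ℕ) (p τ q : ℝ) (hK : KG (Kbar d p τ) q) (i : ℕ) (hi : i < N) :
    rPt d p τ E B (k i) ≤ 0 := by
  have g := H.gap i hi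
  rcases Nat.eq_zero_or_pos i with rfl | h
  · have g' := H.gap (N-1) (by have := H.hN; omega)
    have kN := H.kN
    rw [show N - 1 + 1 = N by have := H.hN; omega] at g'
    exact r_nonpos d p τ q hK H.h (H.mem _ hi.le) H.pred0 (H.succ 0 hi) (by linarith) (by linarith)
  · obtain ⟨j, rfl⟩ : ∃ j, i = j + 1 := ⟨i - 1, by omega⟩
    have g' := H.gap j (by omega)
    exact r_nonpos d p τ q hK H.h (H.mem _ hi.le) (H.pred j (by omega)) (H.succ _ hi)
      (by linarith) (by linarith)

lemma alt (H : Per E B N k L) :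
    Alt (fun u => 2 * ind E u - 1) L N (fun i => if i ≤ N then k i else k 1 + L) := by
  have hN := H.hN
  have hex : ∀ i, ∃ c, i < N → ∀ᵐ u ∂(volume : Measure ℝ), u ∈ Set.Ioo (k i) (k (i+1)) → ind E u = c := by
    intro i
    by_cases hi : i < N
    · obtain ⟨c, hc⟩ := aeconst_Ioo H.h _ _ (H.free i hi)
      exact ⟨c, fun _ => hc⟩
    · exact ⟨0, fun h => absurd h hi⟩
  choose c hc using hex
  have hj : ∀ i, i + 1 < N → (c i = 0 ∧ c (i+1) = 1) ∨ (c i = 1 ∧ c (i+1) = 0) := by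
    intro i hi
    exact jump H.h (H.mono _ _ (by omega) (by omega)) (H.mono _ _ (by omega) (by omega))
      (H.mem (i+1) (by omega)) (H.free i (by omega)) (H.free (i+1) hi) (hc i (by omega)) (hc (i+1) hi)
  have hσ : ∀ i, i < N → 2 * c i - 1 = (2 * c 0 - 1) * (-1)^i := by
    intro i
    induction i with
    | zero => intro _; simp
    | succ i ih =>
      intro hi
      have h1 := ih (by omega)
      rw [pow_succ, ← mul_assoc, ← h1]
      rcases hj i hi with ⟨e1, e2⟩ | ⟨e1, e2⟩ <;> rw [e1, e2] <;> norm_num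
  refine ⟨((ind_meas H.h.1).const_mul 2).sub_const 1, ?_, ?_, by omega, H.even, ?_, ?_, ?_, ?_⟩
  · intro u
    rcases ind_val E u with h | h <;> simp only [h] <;> norm_num
  · intro u
    simp only [ind_per H.per]
  · intro i hi
    rcases hi.lt_or_eq with h | h
    · simp only [hi, show i + 1 ≤ N from h, if_true]
      exact (H.gap i h).le
    · subst h
      have := H.gap 0 (by omega)
      have := H.kN
      simp only [le_refl, if_true, show ¬ (i + 1 ≤ i) by omega, if_false]
      simp only [zero_add] at *
      linarith
  · simp only [le_refl, if_true, Nat.zero_le]; exact H.kN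
  · simp only [show ¬ (N + 1 ≤ N) by omega, if_false, show 1 ≤ N by omega, if_true]
  · refine ⟨2 * c 0 - 1, ?_, ?_⟩
    · rcases hj 0 (by omega) with ⟨e1, e2⟩ | ⟨e1, e2⟩ <;> rw [e1] <;> norm_num
    intro i hi
    rcases hi.lt_or_eq with h | h
    · simp only [hi, show i + 1 ≤ N from h, if_true]
      filter_upwards [hc i h] with u hu hm
      rw [hu hm, hσ i h]
    · subst h
      have kN := H.kN
      simp only [le_refl, if_true, show ¬ (i + 1 ≤ i) by omega, if_false]
      rw [H.even.neg_one_pow, mul_one]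
      have := (measurePreserving_add_right volume (-L)).quasiMeasurePreserving.ae (hc 0 (by omega))
      filter_upwards [this] with u hu hm
      have h2 := hu ⟨by linarith [hm.1], by rw [zero_add]; linarith [hm.2]⟩
      rw [← h2]
      have := ind_per H.per (u + -L)
      rw [neg_add_cancel_right] at this
      rw [this]

lemma psum (H : Per E B N k L) (d : ℕ) (p τ q : ℝ) (hK : KG (Kbar d p τ) q) :
    ∑ i ∈ Finset.range N, rPt d p τ E B (k i) = N * cst d p τ
      - ∫ ρ in Set.Ioi (0:ℝ), Vf (fun u => 2 * ind E u - 1) (k 0) L ρ * Kbar d p τ ρ := by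
  have hN := H.hN
  have kN := H.kN
  obtain ⟨M, rfl⟩ : ∃ M, N = M + 1 := ⟨N - 1, by omega⟩
  have h0 := H.pred0
  have h1 := H.succ M (by omega)
  rw [kN] at h1
  have h2 := H.mono M (M+1) (by omega) le_rfl
  have := period_sum d p τ q hK E B H.h.1 L H.Lpos (ind_per H.per) M k
    (fun i hi => H.mono _ _ (by omega) (by omega)) (by linarith)
    (fun i hi => H.succ i (by omega)) (fun i hi => H.pred i (by omega)) h0 h1
  rw [this]; push_cast; ring

end Per

/-- Comparison with the simple periodic set. -/
lemma part2 {E B : Set ℝ} {N : ℕ} {k : ℕ → ℝ} {L : ℝ} (H : Per E B N k L)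
    (d : ℕ) (p τ q : ℝ) (hK : KG (Kbar d p τ) q) (c h : ℝ) (hh : h = L / N) :
    (∑ᶠ s ∈ ({t : ℝ | ∃ j : ℤ, t = c + j * h} ∩ Set.Ico c (c + L)),
                rPt d p τ {t : ℝ | ∃ j : ℤ, t - c ∈ Set.Ico (2 * j * h) ((2 * j + 1) * h)}
                  {t : ℝ | ∃ j : ℤ, t = c + j * h} s) ≤
    ∑ i ∈ Finset.range N, rPt d p τ E B (k i) := by
  have hN := H.hN
  have kN := H.kN
  have N0 : (0:ℝ) < N := by exact_mod_cast (by omega : 0 < N)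
  have hL : L = N * h := by rw [hh]; field_simp
  have h1 : 1 ≤ h := by
    have : ∀ i ≤ N, k 0 + i ≤ k i := by
      intro i
      induction i with
      | zero => intro _; simp
      | succ i ih =>
        intro hi
        have := ih (by omega)
        have := H.gap i (by omega)
        push_cast; linarith
    have := this N le_rfl
    rw [hh, le_div_iff₀ N0]; linarith
  have h0 : 0 < h := by linarith
  obtain ⟨r, hr⟩ := H.even
  set S := {t : ℝ | ∃ j : ℤ, t - c ∈ Set.Ico (2 * j * h) ((2 * j + 1) * h)} with hS
  set BS := {t : ℝ | ∃ j : ℤ, t = c + j * h} with hBS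
  have Sm : MeasurableSet S := by
    have : S = ⋃ j : ℤ, (fun t => t - c) ⁻¹' Set.Ico (2 * j * h) ((2 * j + 1) * h) := by
      ext t; rw [Set.mem_iUnion]; rfl
    rw [this]
    exact MeasurableSet.iUnion fun j => (measurable_id.sub_const c) measurableSet_Ico
  have Sper : ∀ x, x ∈ S ↔ x + L ∈ S := by
    intro x
    have hNr : (N:ℝ) = 2 * r := by rw [hr]; push_cast; ring
    constructor
    · rintro ⟨j, hj1, hj2⟩
      refine ⟨j + r, ?_, ?_⟩ <;> rw [hL, hNr] <;> push_cast <;> nlinarith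
    · rintro ⟨j, hj1, hj2⟩
      rw [hL, hNr] at hj1 hj2
      refine ⟨j - r, ?_, ?_⟩ <;> push_cast <;> nlinarith
  have memj : ∀ j : ℤ, c + j * h ∈ BS := fun j => ⟨j, rfl⟩
  have freej : ∀ j : ℤ, ∀ u ∈ Set.Ioo (c + j * h) (c + (j+1) * h), u ∉ BS := by
    rintro j u ⟨hu1, hu2⟩ ⟨l, rfl⟩
    have a1 : (j:ℝ) < l := lt_of_mul_lt_mul_right (by linarith) h0.le
    have a2 : (l:ℝ) < j + 1 := lt_of_mul_lt_mul_right (by linarith) h0.le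
    have a1 : j < l := by exact_mod_cast a1
    have a2 : l < j + 1 := by exact_mod_cast a2
    omega
  have succj : ∀ j : ℤ, succPt BS (c + j * h) = (c + (j+1) * h : ℝ) := fun j =>
    succPt_eq (by have := memj (j+1); push_cast at this; exact this) (by linarith) (freej j)
  have predj : ∀ j : ℤ, predPt BS (c + (j+1) * h) = (c + j * h : ℝ) := fun j =>
    predPt_eq (memj j) (by linarith) (freej j)
  have hsum := (fsum_eq (fun i => c + i * h) N (fun i j hij _ => by
      have : (i:ℝ) < j := by exact_mod_cast hij
      show c + i * h < c + j * h
      nlinarith) (BS ∩ Set.Ico c (c + L)) (by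
    intro t
    constructor
    · rintro ⟨⟨j, rfl⟩, a1, a2⟩
      rw [hL] at a2
      have b1 : (0:ℝ) ≤ j := le_of_mul_le_mul_right (by linarith) h0
      have b2 : (j:ℝ) < N := lt_of_mul_lt_mul_right (by linarith) h0.le
      have b1 : 0 ≤ j := by exact_mod_cast b1
      have b2 : j < N := by exact_mod_cast b2
      lift j to ℕ using b1
      exact ⟨j, by exact_mod_cast b2, by simp⟩
    · rintro ⟨i, hi, rfl⟩
      have hi' : (i:ℝ) < N := by exact_mod_cast hi
      refine ⟨⟨i, by simp⟩, ?_, ?_⟩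
      · show c ≤ c + i * h
        have : (0:ℝ) ≤ i * h := by positivity
        linarith
      · show c + i * h < c + L
        rw [hL]; nlinarith) (fun s => rPt d p τ S BS s)).1
  rw [hsum]
  have hps : ∑ i ∈ Finset.range N, rPt d p τ S BS (c + i * h) = N * cst d p τ
      - ∫ ρ in Set.Ioi (0:ℝ), Vf (fun u => 2 * ind S u - 1) c L ρ * Kbar d p τ ρ := by
    obtain ⟨M, hM⟩ : ∃ M, N = M + 1 := ⟨N - 1, by omega⟩
    have hMr : (N:ℝ) = M + 1 := by rw [hM]; push_cast; ring
    have := period_sum d p τ q hK S BS Sm L H.Lpos (ind_per Sper) M (fun i => c + i * h)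
      (fun i _ => by push_cast; linarith) (by push_cast; rw [hL, hMr]; linarith)
      (fun i _ => by have := succj i; push_cast at this ⊢; exact this)
      (fun i _ => by have := predj i; push_cast at this ⊢; exact this)
      (by
        have := predj (-1)
        push_cast at this
        rw [neg_add_cancel] at this
        show predPt BS (c + ((0:ℕ):ℝ) * h) = ((c + M * h - L : ℝ) : EReal)
        rw [hL, hMr, show c + M * h - (M+1) * h = c + -1 * h by ring]
        push_cast
        exact this)
      (by
        have := succj M
        show succPt BS (c + (M:ℝ) * h) = ((c + ((0:ℕ):ℝ) * h + L : ℝ) : EReal)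
        rw [hL, hMr]
        push_cast at this ⊢
        rw [zero_mul, add_zero]
        exact this)
    simp only [Nat.cast_zero, zero_mul, add_zero] at this
    rw [hM, this]; push_cast; ring
  have hvS : ∀ j : ℤ, ∀ u ∈ Set.Ioo (c + j * h) (c + (j+1) * h), (Even j → u ∈ S) ∧ (¬ Even j → u ∉ S) := by
    rintro j u ⟨u1, u2⟩
    constructor
    · rintro ⟨l, rfl⟩
      push_cast at u1 u2
      exact ⟨l, by linarith, by linarith⟩
    · rintro hj ⟨l, l1, l2⟩
      have a1 : (j:ℝ) < 2 * l + 1 := lt_of_mul_lt_mul_right (by linarith) h0.le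
      have a2 : (2 * l:ℝ) < j + 1 := lt_of_mul_lt_mul_right (by linarith) h0.le
      have a1 : j < 2 * l + 1 := by exact_mod_cast a1
      have a2 : 2 * l < j + 1 := by exact_mod_cast a2
      exact hj ⟨l, by omega⟩
  have hAS : Alt (fun u => 2 * ind S u - 1) L N (fun i => c + i * h) := by
    refine ⟨((ind_meas Sm).const_mul 2).sub_const 1, ?_, ?_, by omega, H.even, ?_, ?_, ?_, ?_⟩
    · intro u
      rcases ind_val S u with h | h <;> simp only [h] <;> norm_num
    · intro u
      simp only [ind_per Sper]
    · intro i _; push_cast; linarith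
    · push_cast; rw [hL]; ring
    · push_cast; rw [hL]; ring
    · refine ⟨1, Or.inl rfl, fun i _ => Eventually.of_forall fun u hu => ?_⟩
      have := hvS i u (by push_cast at hu ⊢; exact hu)
      rw [Int.even_coe_nat] at this
      rw [one_mul]
      unfold ind
      by_cases he : Even i
      · rw [Set.indicator_of_mem (this.1 he), he.neg_one_pow]; norm_num
      · rw [Set.indicator_of_notMem (this.2 he), (Nat.not_even_iff_odd.1 he).neg_one_pow]; norm_num
  have hV := V_compare hK H.Lpos H.alt hAS (fun i _ => by push_cast; rw [← hh]; ring)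
  simp only [Nat.zero_le, if_true, Nat.cast_zero, zero_mul, add_zero] at hV
  rw [hps, H.psum d p τ q hK]
  linarith

lemma mk_per (m : ℕ) (hm : 1 ≤ m) (k : ℕ → ℝ) (hmono : ∀ i j : ℕ, i < j → j ≤ m + 2 → k i < k j)
    (hgap : ∀ i j : ℕ, i < j → j ≤ m + 2 → 1 < k j - k i) (kmax : ℝ)
    (hk : kmax = (if m % 2 = 1 then k (m + 1) else k (m + 2))) (Ft BFt : Set ℝ)
    (hFt : IsOneDPerimeterSet Ft BFt) (hper : ∀ x : ℝ, x ∈ Ft ↔ x + (kmax - k 0) ∈ Ft)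
    (hB : BFt ∩ Set.Icc (k 0) kmax = {x | ∃ i, i ≤ m + 2 ∧ x = k i ∧ k i ≤ kmax}) :
    ∃ N, (N = m + 1 ∨ N = m + 2) ∧ kmax = k N ∧ Per Ft BFt N k (kmax - k 0) := by
  have key : ∀ N, (N = m + 1 ∨ N = m + 2) → Even N → kmax = k N → Per Ft BFt N k (kmax - k 0) := by
    intro N hN he hkN
    have hmem : ∀ i ≤ N, k i ∈ BFt := by
      intro i hi
      have : k i ∈ BFt ∩ Set.Icc (k 0) kmax := by
        rw [hB]
        refine ⟨i, by omega, rfl, ?_⟩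
        rw [hkN]
        rcases hi.lt_or_eq with h | h
        · exact (hmono i N h (by omega)).le
        · rw [h]
      exact this.1
    refine ⟨hFt, hper, by omega, he, fun i j hij hj => hmono i j hij (by omega),
      fun i hi => hgap i (i+1) (by omega) (by omega), by rw [hkN]; ring, hmem, ?_⟩
    intro t ht h0 h1
    have : t ∈ BFt ∩ Set.Icc (k 0) kmax := ⟨ht, h0, by rw [hkN]; exact h1⟩
    rw [hB] at this
    obtain ⟨i, hi, rfl, hle⟩ := this
    refine ⟨i, ?_, rfl⟩
    by_contra hc
    exact absurd (hmono N i (by omega) hi) (not_lt.2 h1)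
  by_cases h : m % 2 = 1
  · rw [if_pos h] at hk
    exact ⟨m+1, Or.inl rfl, hk, key _ (Or.inl rfl) (by rw [Nat.even_iff]; omega) hk⟩
  · rw [if_neg h] at hk
    exact ⟨m+2, Or.inr rfl, hk, key _ (Or.inr rfl) (by rw [Nat.even_iff]; omega) hk⟩

/-- One-dimensional optimization: well-separated boundary configurations are controlled,
up to a constant, by their periodization, which in turn is bounded below by the simple
periodic set with the same number of boundary points. -/
theorem statement10 (d : ℕ) (hd : 1 ≤ d) (p : ℝ) (hp : (d : ℝ) + 1 < p) :
    ∃ η₀ τ₀ C : ℝ, 0 < η₀ ∧ 0 < τ₀ ∧ 0 < C ∧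
      ∀ τ : ℝ, 0 < τ → τ < τ₀ →
      ∀ F BF : Set ℝ, IsOneDPerimeterSet F BF →
      ∀ a b : ℝ, a < b →
      ∀ m : ℕ, 1 ≤ m → ∀ k : ℕ → ℝ,
        (BF ∩ Set.Ioo a b = {x | ∃ i, 1 ≤ i ∧ i ≤ m ∧ x = k i}) →
        (∀ i j : ℕ, i < j → j ≤ m + 2 → k i < k j) →
        (∀ i j : ℕ, i < j → j ≤ m + 2 → η₀ < k j - k i) →
        (∀ t ∈ BF \ Set.Ioo a b, η₀ < |t - k 1| ∧ η₀ < |t - k m|) →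
        k 0 ∉ Set.Ioo a b → k (m + 1) ∉ Set.Ioo a b → k (m + 2) ∉ Set.Ioo a b →
        ∀ kmax : ℝ, kmax = (if m % 2 = 1 then k (m + 1) else k (m + 2)) →
        ∀ Ft BFt : Set ℝ, IsOneDPerimeterSet Ft BFt →
          (∀ x : ℝ, x ∈ Ft ↔ x + (kmax - k 0) ∈ Ft) →
          (Ft ∩ Set.Ioo a b = F ∩ Set.Ioo a b) →
          (BFt ∩ Set.Icc (k 0) kmax = {x | ∃ i, i ≤ m + 2 ∧ x = k i ∧ k i ≤ kmax}) →
          ((∑ᶠ s ∈ BFt ∩ Set.Ico (k 0) kmax, rPt d p τ Ft BFt s) - C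
              ≤ ∑ᶠ s ∈ BF ∩ Set.Ioo a b, rPt d p τ F BF s) ∧
          (∀ c : ℝ, ∀ n : ℕ, n = (BFt ∩ Set.Ico (k 0) kmax).ncard →
            ∀ htil : ℝ, htil = (kmax - k 0) / n →
            (∑ᶠ s ∈ ({t : ℝ | ∃ j : ℤ, t = c + j * htil} ∩ Set.Ico c (c + (kmax - k 0))),
                rPt d p τ {t : ℝ | ∃ j : ℤ, t - c ∈ Set.Ico (2 * j * htil) ((2 * j + 1) * htil)}
                  {t : ℝ | ∃ j : ℤ, t = c + j * htil} s)
              ≤ ∑ᶠ s ∈ BFt ∩ Set.Ico (k 0) kmax, rPt d p τ Ft BFt s) := by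
  have hd0 : (1:ℝ) ≤ d := by exact_mod_cast hd
  set q : ℝ := p - d + 1 with hq
  have hCpos : 0 < 4 * (1 / ((q-1)*(q-2))) := by
    have : 0 < q - 1 := by rw [hq]; linarith
    have : 0 < q - 2 := by rw [hq]; linarith
    positivity
  refine ⟨1, 1, 4 * (1 / ((q-1)*(q-2))), one_pos, one_pos, hCpos, ?_⟩
  intro τ τ0 τ1 F BF hF a b hab m hm k hBF hmono hgap hdist hk0 hk1 hk2 kmax hkm Ft BFt hFt hper hI hB
  have hK := Kbar_KG d hd p hp τ τ0 τ1
  rw [← hq] at hK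
  obtain ⟨N, hN, hkN, H⟩ := mk_per m hm k hmono hgap kmax hkm Ft BFt hFt hper hB
  have hfs := H.fs (fun s => rPt d p τ Ft BFt s)
  rw [← hkN] at hfs
  rw [hfs.1, hfs.2]
  refine ⟨?_, fun c n hn htil hh => ?_⟩
  swap
  · subst hn
    exact part2 H d p τ q hK c htil hh
  obtain ⟨M, rfl⟩ : ∃ M, m = M + 1 := ⟨m - 1, by omega⟩
  have hmemI : ∀ i, 1 ≤ i → i ≤ M + 1 → k i ∈ BF ∩ Set.Ioo a b := by
    intro i h1 h2
    rw [hBF]; exact ⟨i, h1, h2, rfl⟩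
  have hfF := (fsum_eq (fun i => k (i+1)) (M+1) (fun i j hij hj => hmono _ _ (by omega) (by omega))
    (BF ∩ Set.Ioo a b) (by
      intro t
      rw [hBF]
      constructor
      · rintro ⟨i, h1, h2, rfl⟩
        exact ⟨i - 1, by omega, by show k i = k (i - 1 + 1); congr 1; omega⟩
      · rintro ⟨i, h1, rfl⟩
        exact ⟨i+1, by omega, by omega, rfl⟩) (fun s => rPt d p τ F BF s)).1
  rw [hfF]
  have hle : ∀ i j, i ≤ j → j ≤ M + 1 + 2 → k i ≤ k j := by
    intro i j hij hj
    rcases hij.lt_or_eq with h | h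
    · exact (hmono i j h hj).le
    · rw [h]
  have i1 := (hmemI 1 le_rfl (by omega)).2
  have iM := (hmemI (M+1) (by omega) le_rfl).2
  have free : ∀ i < M, ∀ u ∈ Set.Ioo (k (i+1)) (k (i+1+1)), u ∉ BF := by
    intro i hi u hu hb
    have : u ∈ BF ∩ Set.Ioo a b := ⟨hb, by
      have := (hmemI (i+1) (by omega) (by omega)).2.1
      linarith [hu.1], by
      have := (hmemI (i+1+1) (by omega) (by omega)).2.2
      linarith [hu.2]⟩
    rw [hBF] at this
    obtain ⟨j, h1, h2, rfl⟩ := this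
    rcases le_or_gt j (i+1) with h | h
    · exact absurd (hle j (i+1) h (by omega)) (not_le.2 hu.1)
    · exact absurd (hle (i+1+1) j h (by omega)) (not_le.2 hu.2)
  have hcore := part1_core d p τ q hK hF hFt a b hI M (fun i => k (i+1))
    (fun i hi => hmono _ _ (by omega) (by omega)) (hle _ _ (by omega) (by omega)) i1.1 iM.2
    (fun i hi => succPt_eq (hmemI _ (by omega) (by omega)).1 (hmono _ _ (by omega) (by omega)) (free i hi))
    (fun i hi => predPt_eq (hmemI _ (by omega) (by omega)).1 (hmono _ _ (by omega) (by omega)) (free i hi))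
    (fun i hi => H.succ _ (by omega)) (fun i hi => H.pred _ (by omega))
    (by
      intro t ht hlt
      have hlt : t < k 1 := hlt
      show t ≤ k 1 - 1
      by_cases hti : t ∈ Set.Ioo a b
      · have : t ∈ BF ∩ Set.Ioo a b := ⟨ht, hti⟩
        rw [hBF] at this
        obtain ⟨j, h1, h2, rfl⟩ := this
        exact absurd (hle 1 j h1 (by omega)) (not_le.2 hlt)
      · have := (hdist t ⟨ht, hti⟩).1
        rw [abs_of_neg (by linarith)] at this
        linarith)
    (by
      intro t ht hlt
      have hlt : k (M+1) < t := hlt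
      show k (M+1) + 1 ≤ t
      by_cases hti : t ∈ Set.Ioo a b
      · have : t ∈ BF ∩ Set.Ioo a b := ⟨ht, hti⟩
        rw [hBF] at this
        obtain ⟨j, h1, h2, rfl⟩ := this
        exact absurd (hle j (M+1) h2 (by omega)) (not_le.2 hlt)
      · have := (hdist t ⟨ht, hti⟩).2
        rw [abs_of_pos (by linarith)] at this
        linarith)
    (k 0) (k (M+1+1))
    (by have := hgap 0 1 (by omega) (by omega); show k 0 ≤ k 1 - 1; linarith)
    (by have := hgap (M+1) (M+1+1) (by omega) (by omega); show k (M+1) + 1 ≤ k (M+1+1); linarith)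
    (H.pred 0 (by omega)) (H.succ (M+1) (by omega))
  have hred : ∑ i ∈ Finset.range N, rPt d p τ Ft BFt (k i) ≤
      ∑ i ∈ Finset.range (M+1), rPt d p τ Ft BFt (k (i+1)) := by
    have n0 := H.nonpos d p τ q hK 0 (by omega)
    rcases hN with rfl | rfl
    · rw [Finset.sum_range_succ']
      linarith
    · have n1 := H.nonpos d p τ q hK (M+1+1) (by omega)
      rw [Finset.sum_range_succ', Finset.sum_range_succ]
      linarith
  linarith

end
end
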